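/- arXiv:1408.0451 — 2 statements merged into one kernel-verified Lean document; each statement's English description precedes it below -/
import Mathlib

section
/- Let w be a generalized trapezoidal word with heart v, let p be the longest palindromic prefix of v and q the longest palindromic suffix of v, and suppose v = p·x·q for a single letter x, where Alph(p) ⊆ Alph(q) or Alph(q) ⊆ Alph(p). Then w is rich if and only if x ∈ Alph(p) ∪ Alph(q). -/
open List

variable {A : Type*} [DecidableEq A]

/-- The alphabet of a word: the finite set of distinct letters occurring in it. -/
def Alph (w : List A) : Finset A := w.toFinset

/-- The finset of all factors (contiguous subwords) of `w`. -/
def factors (w : List A) : Finset (List A) :=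
  ((Finset.range (w.length + 1)) ×ˢ (Finset.range (w.length + 1))).image
    (fun p => (w.drop p.1).take p.2)

/-- Factor complexity: the number of distinct factors of `w` of length `n`. -/
def C (w : List A) (n : ℕ) : ℕ := ((factors w).filter (fun u => u.length = n)).card

/-- Right-valence of `u` in `w`: the number of distinct letters `x` such that `u ++ [x]`
is a factor of `w`. -/
def rightValence (w u : List A) : ℕ := ((Alph w).filter (fun x => u ++ [x] <:+: w)).card

/-- `u` is a right special factor of `w`. -/
def RightSpecial (w u : List A) : Prop := u <:+: w ∧ 2 ≤ rightValence w u

/-- `R w`: the smallest positive integer `r` such that `w` has no right special factor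
of length `r`. -/
noncomputable def R (w : List A) : ℕ :=
  sInf {r : ℕ | 0 < r ∧ ∀ u : List A, u.length = r → ¬ RightSpecial w u}

/-- The number of occurrences of `u` as a factor of `w`. -/
def occCount (w u : List A) : ℕ :=
  ((Finset.range (w.length + 1)).filter
    (fun i => i + u.length ≤ w.length ∧ (w.drop i).take u.length = u)).card

/-- `K w`: the length of the shortest suffix of `w` occurring exactly once in `w`. -/
noncomputable def K (w : List A) : ℕ :=
  sInf {k : ℕ | ∃ u : List A, u <:+ w ∧ u.length = k ∧ occCount w u = 1}

/-- Left-valence of `u` in `w`. -/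
def leftValence (w u : List A) : ℕ := ((Alph w).filter (fun x => x :: u <:+: w)).card

/-- `u` is a left special factor of `w`. -/
def LeftSpecial (w u : List A) : Prop := u <:+: w ∧ 2 ≤ leftValence w u

/-- `L w`: the smallest positive integer `ℓ` such that `w` has no left special factor
of length `ℓ`. -/
noncomputable def L (w : List A) : ℕ :=
  sInf {r : ℕ | 0 < r ∧ ∀ u : List A, u.length = r → ¬ LeftSpecial w u}

/-- `H w`: the length of the shortest prefix of `w` occurring exactly once in `w`. -/
noncomputable def H (w : List A) : ℕ :=
  sInf {k : ℕ | ∃ u : List A, u <+: w ∧ u.length = k ∧ occCount w u = 1}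

/-- A generalized trapezoidal word. -/
def IsGT (w : List A) : Prop :=
  w ≠ [] ∧ ((Alph w).card = 1 ∨
    ∃ m M : ℕ, 0 < m ∧ m ≤ M ∧
      (∀ i, 1 ≤ i → i ≤ m → C w i = (Alph w).card + i - 1) ∧
      (∀ i, m ≤ i → i ≤ M - 1 → C w (i + 1) = C w i) ∧
      (∀ i, M ≤ i → i ≤ w.length → C w (i + 1) = C w i - 1))

/-- The heart of a word: remove the longest prefix and longest suffix consisting of
letters that occur exactly once in the word (if some letter repeats); otherwise the
word itself. -/
def heart (w : List A) : List A :=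
  if ∀ x ∈ w, w.count x = 1 then w
  else
    ((w.dropWhile (fun x => w.count x == 1)).reverse.dropWhile
      (fun x => w.count x == 1)).reverse

/-- A word is rich if it has exactly `|w| + 1` distinct palindromic factors. -/
def Rich (w : List A) : Prop :=
  ((factors w).filter (fun u => u.reverse = u)).card = w.length + 1

/-- `p` is a period of `w`. -/
def IsPeriod (w : List A) (p : ℕ) : Prop :=
  0 < p ∧ ∀ i : ℕ, i + p < w.length → w[i]? = w[i + p]?

/-- The minimal period of `w`. -/
noncomputable def minPeriod (w : List A) : ℕ := sInf {p : ℕ | IsPeriod w p}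

set_option linter.unusedSectionVars false

/-! ### Factors -/

theorem mem_factors_iff (w u : List A) : u ∈ factors w ↔ u <:+: w := by
  unfold factors
  simp only [Finset.mem_image, Finset.mem_product, Finset.mem_range, Prod.exists]
  constructor
  · rintro ⟨i, j, -, rfl⟩
    exact (List.take_prefix _ _).isInfix.trans (List.drop_suffix _ _).isInfix
  · rintro ⟨s, t, rfl⟩
    refine ⟨s.length, u.length, ⟨by simp only [List.length_append]; omega, by simp only [List.length_append]; omega⟩, ?_⟩
    simp

theorem infix_concat_iff (w u : List A) (z : A) :
    u <:+: w ++ [z] ↔ u <:+: w ∨ u <:+ w ++ [z] := by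
  rw [List.infix_concat_iff]
  tauto

/-- The set of factors of length `n`. -/
def facLen (w : List A) (n : ℕ) : Finset (List A) := (factors w).filter (fun u => u.length = n)

theorem C_eq (w : List A) (n : ℕ) : C w n = (facLen w n).card := rfl

theorem mem_facLen (w u : List A) (n : ℕ) : u ∈ facLen w n ↔ u <:+: w ∧ u.length = n := by
  simp [facLen, mem_factors_iff]

theorem facLen_reverse (w : List A) (n : ℕ) :
    facLen w.reverse n = (facLen w n).image List.reverse := by
  ext u
  simp only [Finset.mem_image, mem_facLen]
  constructor
  · rintro ⟨h, h2⟩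
    refine ⟨u.reverse, ⟨?_, by simpa using h2⟩, by simp⟩
    rw [← List.reverse_infix]; simpa using h
  · rintro ⟨t, ⟨h, h2⟩, rfl⟩
    exact ⟨List.reverse_infix.2 h, by simpa using h2⟩

theorem C_reverse (w : List A) (n : ℕ) : C w.reverse n = C w n := by
  rw [C_eq, C_eq, facLen_reverse, Finset.card_image_of_injective _ List.reverse_injective]

theorem C_one (w : List A) : C w 1 = (Alph w).card := by
  rw [C_eq]
  have : facLen w 1 = (Alph w).image (fun x => [x]) := by
    ext u
    simp only [mem_facLen, Finset.mem_image, Alph, List.mem_toFinset]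
    constructor
    · rintro ⟨h, h2⟩
      obtain ⟨a, rfl⟩ := List.length_eq_one_iff.1 h2
      exact ⟨a, h.subset (by simp), rfl⟩
    · rintro ⟨a, ha, rfl⟩
      obtain ⟨s, t, rfl⟩ := List.append_of_mem ha
      exact ⟨⟨s, t, by simp⟩, rfl⟩
  rw [this, Finset.card_image_of_injective]
  intro a b h; simpa using h

theorem C_big (w : List A) (n : ℕ) (h : w.length < n) : C w n = 0 := by
  rw [C_eq, Finset.card_eq_zero, Finset.eq_empty_iff_forall_notMem]
  intro u hu
  rw [mem_facLen] at hu
  have := hu.1.length_le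
  omega

/-- The growth condition extracted from the definition of GT-words. -/
def Grow (w : List A) : Prop := ∀ i, 1 ≤ i → C w (i + 1) ≤ C w i + 1

theorem Grow.reverse {w : List A} (h : Grow w) : Grow w.reverse := by
  intro i hi
  rw [C_reverse, C_reverse]; exact h i hi

theorem IsGT.grow {w : List A} (h : IsGT w) : Grow w := by
  intro i hi
  obtain ⟨hne, h1 | ⟨m, M, hm, hmM, h1, h2, h3⟩⟩ := h
  · have key : C w (i + 1) ≤ 1 := by
      rw [C_eq, Finset.card_le_one]
      obtain ⟨a, ha⟩ := Finset.card_eq_one.1 h1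
      have hall : ∀ x ∈ w, x = a := by
        intro x hx
        have : x ∈ Alph w := by simpa [Alph] using hx
        simpa [ha] using this
      intro u hu u' hu'
      rw [mem_facLen] at hu hu'
      have e1 : u = List.replicate (i+1) a :=
        List.eq_replicate_iff.2 ⟨hu.2, fun b hb => hall b (hu.1.subset hb)⟩
      have e2 : u' = List.replicate (i+1) a :=
        List.eq_replicate_iff.2 ⟨hu'.2, fun b hb => hall b (hu'.1.subset hb)⟩
      rw [e1, e2]
    omega
  · by_cases c1 : i < m
    · rw [h1 i hi c1.le, h1 (i+1) (by omega) (by omega)]; omega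
    by_cases c2 : i ≤ M - 1
    · rw [h2 i (by omega) c2]; omega
    by_cases c3 : i ≤ w.length
    · rw [h3 i (by omega) c3]; omega
    · rw [C_big w (i+1) (by omega)]; omega

theorem C_concat (w : List A) (z : A) (hz : z ∉ w) (n : ℕ) (h1 : 1 ≤ n) (h2 : n ≤ w.length + 1) :
    C (w ++ [z]) n = C w n + 1 := by
  rw [C_eq, C_eq]
  have key : facLen (w ++ [z]) n = insert ((w ++ [z]).drop (w.length + 1 - n)) (facLen w n) := by
    ext u
    rw [Finset.mem_insert, mem_facLen, mem_facLen, _root_.infix_concat_iff]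
    constructor
    · rintro ⟨h | h, hl⟩
      · exact Or.inr ⟨h, hl⟩
      · left
        rw [List.suffix_iff_eq_drop] at h
        rw [h, hl]; simp
    · rintro (rfl | h)
      · refine ⟨Or.inr (List.drop_suffix _ _), by simp; omega⟩
      · exact ⟨Or.inl h.1, h.2⟩
  rw [key, Finset.card_insert_of_notMem]
  rw [mem_facLen]
  rintro ⟨h, -⟩
  apply hz
  apply h.subset
  rw [List.drop_append_of_le_length (by omega)]
  simp

theorem Grow.of_concat {w : List A} {z : A} (hz : z ∉ w) (h : Grow (w ++ [z])) : Grow w := by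
  intro i hi
  by_cases hw : i ≤ w.length
  · have := h i hi
    rw [C_concat w z hz _ (by omega) (by omega), C_concat w z hz _ (by omega) (by omega)] at this
    omega
  · rw [C_big w (i+1) (by omega)]; omega

theorem Grow.of_cons {w : List A} {z : A} (hz : z ∉ w) (h : Grow (z :: w)) : Grow w := by
  have := h.reverse
  rw [List.reverse_cons] at this
  have := (this.of_concat (by simpa using hz)).reverse
  simpa using this

/-! ### Palindromic factors -/

/-- The set of palindromic factors. -/
def palset (w : List A) : Finset (List A) := (factors w).filter (fun u => u.reverse = u)

theorem rich_iff (w : List A) : Rich w ↔ (palset w).card = w.length + 1 := Iff.rfl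

theorem mem_palset (w u : List A) : u ∈ palset w ↔ u <:+: w ∧ u.reverse = u := by
  simp [palset, mem_factors_iff]

theorem palset_reverse (w : List A) : palset w.reverse = palset w := by
  ext u
  rw [mem_palset, mem_palset]
  constructor
  · rintro ⟨h, h2⟩
    refine ⟨?_, h2⟩
    rw [← List.reverse_infix, h2]; exact h
  · rintro ⟨h, h2⟩
    refine ⟨?_, h2⟩
    rw [← h2]; exact List.reverse_infix.2 h

theorem rich_reverse (w : List A) : Rich w.reverse ↔ Rich w := by
  rw [rich_iff, rich_iff, palset_reverse, List.length_reverse]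

theorem palset_concat (w u : List A) (z : A) (hu : u <:+ w ++ [z]) (hup : u.reverse = u)
    (hmax : ∀ t : List A, t <:+ w ++ [z] → t.reverse = t → t.length ≤ u.length) :
    palset (w ++ [z]) = insert u (palset w) := by
  ext t
  rw [Finset.mem_insert, mem_palset, mem_palset, _root_.infix_concat_iff]
  constructor
  · rintro ⟨h | h, ht⟩
    · exact Or.inr ⟨h, ht⟩
    · have hle := hmax t h ht
      have hs : t <:+ u := List.suffix_of_suffix_length_le h hu hle
      by_cases he : t = u
      · exact Or.inl he
      · right
        refine ⟨?_, ht⟩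
        have hpre : t <+: u := by
          rw [← List.reverse_suffix, ht, hup]; exact hs
        obtain ⟨r, rfl⟩ := hpre
        have hr : r ≠ [] := by rintro rfl; simp at he
        obtain ⟨s, hs⟩ := hu
        obtain ⟨r', b, rfl⟩ := List.eq_nil_or_concat r |>.resolve_left hr
        have : (s ++ t ++ r') ++ [b] = w ++ [z] := by rw [← hs]; simp
        have := (List.append_inj' this rfl).1
        exact ⟨s, r', this⟩
  · rintro (rfl | h)
    · exact ⟨Or.inr hu, hup⟩
    · exact ⟨Or.inl h.1, h.2⟩

theorem exists_lps (w : List A) : ∃ u : List A, u <:+ w ∧ u.reverse = u ∧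
    ∀ t : List A, t <:+ w → t.reverse = t → t.length ≤ u.length := by
  obtain ⟨u, hu, hm⟩ := Finset.exists_max_image ((palset w).filter (fun u => u <:+ w)) List.length
    ⟨[], by simp [mem_palset]⟩
  simp only [Finset.mem_filter, mem_palset] at hu hm
  exact ⟨u, hu.2, hu.1.2, fun t ht htp => hm t ⟨⟨ht.isInfix, htp⟩, ht⟩⟩

theorem card_palset_concat_le (w : List A) (z : A) :
    (palset (w ++ [z])).card ≤ (palset w).card + 1 := by
  obtain ⟨u, h1, h2, h3⟩ := exists_lps (w ++ [z])
  rw [palset_concat w u z h1 h2 h3]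
  exact Finset.card_insert_le _ _

theorem card_palset_append_le (w t : List A) :
    (palset (w ++ t)).card ≤ (palset w).card + t.length := by
  induction t using List.reverseRecOn with
  | nil => simp
  | append_singleton t z ih =>
    have := card_palset_concat_le (w ++ t) z
    rw [← List.append_assoc]
    simp only [List.length_append, List.length_singleton]; omega

theorem palset_nil : palset ([] : List A) = {[]} := by
  ext u
  simp only [mem_palset, Finset.mem_singleton]
  constructor
  · rintro ⟨h, -⟩; simpa using h
  · rintro rfl; simp

theorem card_palset_le (w : List A) : (palset w).card ≤ w.length + 1 := by
  have := card_palset_append_le [] w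
  rw [palset_nil] at this
  simp at this; omega

theorem rich_concat_iff (w : List A) (z : A) (hz : z ∉ w) : Rich (w ++ [z]) ↔ Rich w := by
  rw [rich_iff, rich_iff, palset_concat w [z] z ⟨w, rfl⟩ rfl, Finset.card_insert_of_notMem]
  · simp
  · rw [mem_palset]
    rintro ⟨h, -⟩
    exact hz (h.subset (by simp))
  · intro t ht htp
    rcases List.eq_nil_or_concat t with rfl | ⟨t', b, rfl⟩
    · simp
    · obtain ⟨s, hs⟩ := ht
      rw [List.concat_eq_append] at *
      rw [← List.append_assoc] at hs
      have h1 := List.append_inj' hs rfl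
      have hb : b = z := by simpa using h1.2
      subst hb
      rcases t' with _ | ⟨c, t'⟩
      · simp
      · exfalso
        simp at htp
        apply hz
        rw [← h1.1, ← htp.1]; simp

theorem rich_cons_iff (w : List A) (z : A) (hz : z ∉ w) : Rich (z :: w) ↔ Rich w := by
  rw [← rich_reverse, List.reverse_cons, rich_concat_iff _ _ (by simpa using hz), rich_reverse]

/-! ### Reduction to the heart -/

theorem peel_suffix (v s : List A) (hg : Grow (v ++ s))
    (h : ∀ x ∈ s, (v ++ s).count x = 1) : Grow v ∧ (Rich (v ++ s) ↔ Rich v) := by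
  induction s using List.reverseRecOn with
  | nil => simpa using hg
  | append_singleton s z ih =>
    have hz : z ∉ v ++ s := by
      have := h z (by simp)
      rw [← List.append_assoc, List.count_append] at this
      simp only [List.count_singleton_self] at this
      exact List.count_eq_zero.1 (by omega)
    rw [← List.append_assoc] at hg ⊢
    have hg' := hg.of_concat hz
    obtain ⟨h1, h2⟩ := ih hg' (by
      intro x hx
      have hxz : x ≠ z := by rintro rfl; exact hz (by simp [hx])
      have := h x (by simp [hx])
      rw [← List.append_assoc, List.count_append] at this
      simpa [hxz.symm] using this)
    exact ⟨h1, (rich_concat_iff _ _ hz).trans h2⟩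

theorem heart_reduce (w : List A) (hg : Grow w) :
    Grow (heart w) ∧ (Rich w ↔ Rich (heart w)) := by
  unfold heart
  split_ifs with h
  · exact ⟨hg, Iff.rfl⟩
  · set P : A → Bool := fun x => w.count x == 1 with hP
    have e1 : w = w.takeWhile P ++ w.dropWhile P := (List.takeWhile_append_dropWhile).symm
    set d := w.dropWhile P with hd
    have e2 : d = (d.reverse.dropWhile P).reverse ++ (d.reverse.takeWhile P).reverse := by
      rw [← List.reverse_append, List.takeWhile_append_dropWhile, List.reverse_reverse]
    set r := w.takeWhile P with hr
    set v := (d.reverse.dropWhile P).reverse with hv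
    set s := (d.reverse.takeWhile P).reverse with hs
    have hr1 : ∀ x ∈ r, w.count x = 1 := by
      intro x hx
      have := List.mem_takeWhile_imp hx
      simpa [hP] using this
    have hs1 : ∀ x ∈ s, w.count x = 1 := by
      intro x hx
      rw [hs, List.mem_reverse] at hx
      have := List.mem_takeWhile_imp hx
      simpa [hP] using this
    have q1 := peel_suffix d.reverse r.reverse
      (by rw [← List.reverse_append, ← e1]; exact hg.reverse)
      (by intro x hx
          rw [← List.reverse_append, ← e1, List.count_reverse]
          exact hr1 x (by simpa using hx))
    rw [← List.reverse_append, ← e1, rich_reverse, rich_reverse] at q1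
    have hgd : Grow d := by simpa using q1.1.reverse
    have q2 := peel_suffix v s (by rw [← e2]; exact hgd)
      (by intro x hx
          rw [← e2]
          have h1 := hs1 x hx
          rw [e1, List.count_append] at h1
          have : 0 < d.count x := by
            rw [e2]; exact List.count_pos_iff.2 (by simp [hx])
          omega)
    rw [← e2] at q2
    exact ⟨q2.1, q1.2.trans q2.2⟩

/-! ### Non-palindromic complete returns -/

/-- A non-palindromic word having a palindromic border that occurs exactly as prefix and suffix. -/
def Bad (z : List A) : Prop :=
  z.reverse ≠ z ∧ ∃ u : List A, u.reverse = u ∧ u <+: z ∧ u <:+ z ∧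
    ∀ s t : List A, z = s ++ u ++ t → s = [] ∨ t = []

theorem exists_last_occ (w u : List A) (h : u <:+: w) :
    ∃ s t : List A, w = s ++ u ++ t ∧ ∀ s' t' : List A, w = s' ++ u ++ t' → t.length ≤ t'.length := by
  classical
  have hex : ∃ n, ∃ s t : List A, w = s ++ u ++ t ∧ t.length = n := by
    obtain ⟨s, t, h⟩ := h
    exact ⟨t.length, s, t, h.symm, rfl⟩
  obtain ⟨s, t, h1, h2⟩ := Nat.find_spec hex
  refine ⟨s, t, h1, fun s' t' h' => ?_⟩
  rw [h2]
  exact Nat.find_min' hex ⟨s', t', h', rfl⟩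

theorem rich_of_not_bad (w : List A) (h : ∀ z : List A, z <:+: w → ¬ Bad z) : Rich w := by
  induction w using List.reverseRecOn with
  | nil => rw [rich_iff, palset_nil]; simp
  | append_singleton w c ih =>
    have ihw := ih (fun z hz => h z (hz.trans ⟨[], [c], by simp⟩))
    rw [rich_iff] at ihw ⊢
    obtain ⟨u, h1, h2, h3⟩ := exists_lps (w ++ [c])
    rw [palset_concat w u c h1 h2 h3, Finset.card_insert_of_notMem, ihw]
    · simp
    · rw [mem_palset]
      rintro ⟨hu, -⟩
      obtain ⟨s, t, hst, hmin⟩ := exists_last_occ w u hu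
      have hsuf : u ++ t ++ [c] <:+ w ++ [c] := ⟨s, by rw [hst]; simp⟩
      apply h (u ++ t ++ [c]) hsuf.isInfix
      refine ⟨?_, u, h2, ⟨t ++ [c], by simp⟩, ?_, ?_⟩
      · intro hp
        have := h3 _ hsuf hp
        simp at this
      · exact List.suffix_of_suffix_length_le h1 hsuf (by simp)
      · intro s' t' hz
        by_contra hcon
        push Not at hcon
        obtain ⟨hs', ht'⟩ := hcon
        obtain ⟨t'', b, rfl⟩ := (List.eq_nil_or_concat t').resolve_left ht'
        rw [List.concat_eq_append, ← List.append_assoc] at hz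
        have hz' := (List.append_inj' hz rfl).1
        have hl := hmin (s ++ s') t'' (by rw [hst, List.append_assoc, hz']; simp)
        have := congrArg List.length hz'
        simp at this
        have : 0 < s'.length := List.length_pos_iff.2 hs'
        omega

/-! ### The strong-bispecial-free property and desubstitution -/

/-- No strong bispecial factor. -/
def TT (w : List A) : Prop :=
  ∀ (s : List A) (x x' y y' : A), x ≠ x' → y ≠ y' → x :: (s ++ [y]) <:+: w → x :: (s ++ [y']) <:+: w →
    x' :: (s ++ [y]) <:+: w → x' :: (s ++ [y']) <:+: w → False

theorem TT.mono {w z : List A} (h : TT w) (hz : z <:+: w) : TT z :=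
  fun s x x' y y' h1 h2 a b c d =>
    h s x x' y y' h1 h2 (a.trans hz) (b.trans hz) (c.trans hz) (d.trans hz)

/-- The letter `a` separates `w`. -/
def SepL (a : A) (w : List A) : Prop := ∀ y y' : A, [y, y'] <:+: w → y = a ∨ y' = a

theorem SepL.mono {a : A} {w z : List A} (h : SepL a w) (hz : z <:+: w) : SepL a z :=
  fun y y' h1 => h y y' (h1.trans hz)

/-- The episturmian-type morphism. -/
def phi (a : A) : List A → List A
  | [] => []
  | y :: t => if y = a then a :: phi a t else a :: y :: phi a t

theorem phi_append (a : A) (s t : List A) : phi a (s ++ t) = phi a s ++ phi a t := by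
  induction s with
  | nil => rfl
  | cons y s ih => simp only [List.cons_append, phi, ih]; split_ifs <;> simp

theorem phi_reverse (a : A) (t : List A) :
    (phi a t ++ [a]).reverse = phi a t.reverse ++ [a] := by
  induction t with
  | nil => rfl
  | cons y t ih =>
    rw [List.reverse_cons, phi_append]
    simp only [List.reverse_append, List.reverse_singleton, List.singleton_append] at ih ⊢
    have : (phi a (y :: t)).reverse = (phi a t).reverse ++ (phi a [y]).reverse := by
      rw [← List.reverse_append, ← phi_append]; rfl
    rw [this, ← List.cons_append, ih]
    by_cases h : y = a <;> simp [phi, h]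

theorem phi_length (a : A) (t : List A) :
    (phi a t).length = t.length + t.countP (fun y => decide (y ≠ a)) := by
  induction t with
  | nil => rfl
  | cons y t ih =>
    by_cases h : y = a <;> simp [phi, h] at ih ⊢ <;> omega

theorem phi_head (a : A) (t : List A) : ∃ r : List A, phi a t ++ [a] = a :: r := by
  cases t with
  | nil => exact ⟨[], rfl⟩
  | cons y t => by_cases h : y = a <;> simp [phi, h]

theorem phi_prefix (a : A) (u z : List A) (h : phi a u ++ [a] <+: phi a z ++ [a]) : u <+: z := by
  induction u generalizing z with
  | nil => simp
  | cons y u ih =>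
    cases z with
    | nil =>
      have := h.length_le
      rw [List.length_append, phi_length, List.length_append, phi_length] at this
      simp at this
    | cons y' z =>
      have hu := phi_head a u
      have hz := phi_head a z
      by_cases h1 : y = a <;> by_cases h2 : y' = a
      · simp only [phi, h1, h2, if_true, List.cons_append, List.cons_prefix_cons, true_and] at h ⊢
        exact ih _ h
      · exfalso
        simp only [phi, h1, h2, if_true, if_false, List.cons_append, List.cons_prefix_cons, true_and] at h
        obtain ⟨r, hr⟩ := hu
        rw [hr, List.cons_prefix_cons] at h
        exact h2 h.1.symm
      · exfalso
        simp only [phi, h1, h2, if_true, if_false, List.cons_append, List.cons_prefix_cons, true_and] at h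
        obtain ⟨r, hr⟩ := hz
        rw [hr, List.cons_prefix_cons] at h
        exact h1 h.1
      · simp only [phi, h1, h2, if_false, List.cons_append, List.cons_prefix_cons, true_and] at h ⊢
        exact ⟨h.1, ih _ h.2⟩

theorem phi_inj (a : A) (u z : List A) (h : phi a u ++ [a] = phi a z ++ [a]) : u = z := by
  have h1 := phi_prefix a u z (h ▸ List.prefix_rfl)
  have h2 := phi_prefix a z u (h ▸ List.prefix_rfl)
  exact List.IsPrefix.eq_of_length h1 (le_antisymm h1.length_le h2.length_le)

theorem phi_suffix (a : A) (u z : List A) (h : phi a u ++ [a] <:+ phi a z ++ [a]) : u <:+ z := by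
  rw [← List.reverse_prefix, phi_reverse, phi_reverse] at h
  have := phi_prefix _ _ _ h
  rwa [List.reverse_prefix] at this

theorem phi_pal (a : A) (t : List A) :
    (phi a t ++ [a]).reverse = phi a t ++ [a] ↔ t.reverse = t := by
  rw [phi_reverse]
  exact ⟨fun h => phi_inj _ _ _ h, fun h => by rw [h]⟩

/-- Decoding. -/
theorem phi_decode (a : A) (r : List A) (hs : SepL a (r ++ [a])) (hh : (r ++ [a]).head? = some a) :
    ∃ t : List A, r = phi a t := by
  induction hn : r.length using Nat.strong_induction_on generalizing r with
  | _ n ih =>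
    rcases r with _ | ⟨y, r⟩
    · exact ⟨[], rfl⟩
    · simp at hh
      subst hh
      rcases r with _ | ⟨b, r⟩
      · exact ⟨[y], by simp [phi]⟩
      · by_cases hb : b = y
        · subst hb
          obtain ⟨t, ht⟩ := ih _ (by simp at hn ⊢; omega) (b :: r)
            (hs.mono ⟨[b], [], by simp⟩) (by simp) rfl
          exact ⟨b :: t, by simp [phi, ht]⟩
        · have hh2 : (r ++ [y]).head? = some y := by
            rcases r with _ | ⟨c, r⟩
            · rfl
            · have := hs b c ⟨[y], r ++ [y], by simp⟩
              simp; tauto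
          obtain ⟨t, ht⟩ := ih _ (by simp at hn ⊢; omega) r
            (hs.mono ⟨[y, b], [], by simp⟩) hh2 rfl
          exact ⟨b :: t, by simp [phi, ht, hb]⟩

theorem phi_mem (a : A) (t : List A) (y : A) (hy : y ∈ t) : y ∈ phi a t := by
  induction t with
  | nil => simp at hy
  | cons b t ih =>
    simp only [phi]
    rcases List.mem_cons.1 hy with rfl | h
    · split_ifs with h <;> simp [h]
    · split_ifs <;> simp [ih h]

theorem phi_sub (a : A) (t : List A) (y : A) (hy : y ∈ phi a t) : y = a ∨ y ∈ t := by
  induction t with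
  | nil => simp [phi] at hy
  | cons b t ih =>
    simp only [phi] at hy
    split_ifs at hy <;> simp at hy ⊢ <;> tauto

theorem phi_aa (a : A) (t : List A) (h : a ∈ t) : [a, a] <:+: phi a t ++ [a] := by
  obtain ⟨s, r, rfl⟩ := List.append_of_mem h
  obtain ⟨r', hr'⟩ := phi_head a r
  refine ⟨phi a s, r', ?_⟩
  rw [phi_append]
  simp only [phi, if_true, List.append_assoc, List.cons_append, List.nil_append, hr']

/-- Transfer of occurrences through the morphism. -/
theorem phi_occ (a : A) (s z : List A) (x y : A) (h : x :: (s ++ [y]) <:+: z) :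
    x :: (phi a s ++ [a] ++ [y]) <:+: phi a z ++ [a] := by
  obtain ⟨l, r, rfl⟩ := h
  obtain ⟨r', hr'⟩ := phi_head a r
  have hx : ∃ b : List A, phi a [x] = b ++ [x] := by
    by_cases h : x = a
    · exact ⟨[], by simp [phi, h]⟩
    · exact ⟨[a], by simp [phi, h]⟩
  have hy : ∃ b : List A, phi a [y] ++ (phi a r ++ [a]) = a :: y :: b := by
    by_cases h : y = a
    · exact ⟨r', by simp [phi, h, hr']⟩
    · exact ⟨phi a r ++ [a], by simp [phi, h]⟩
  obtain ⟨b, hb⟩ := hx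
  obtain ⟨b', hb'⟩ := hy
  refine ⟨phi a l ++ b, b', ?_⟩
  have e : l ++ x :: (s ++ [y]) ++ r = l ++ ([x] ++ (s ++ ([y] ++ r))) := by simp
  rw [e, phi_append, phi_append, phi_append, phi_append, hb]
  simp only [List.append_assoc]
  rw [hb']
  simp

theorem phi_TT (a : A) (z : List A) (h : TT (phi a z ++ [a])) : TT z :=
  fun s x x' y y' h1 h2 p1 p2 p3 p4 =>
    h (phi a s ++ [a]) x x' y y' h1 h2 (phi_occ _ _ _ _ _ p1) (phi_occ _ _ _ _ _ p2)
      (phi_occ _ _ _ _ _ p3) (phi_occ _ _ _ _ _ p4)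

theorem Bad.two {z : List A} (h : Bad z) : 2 ≤ z.length := by
  by_contra hl
  apply h.1
  rcases z with _ | ⟨a, _ | ⟨b, z⟩⟩ <;> simp at hl ⊢

theorem Bad.border_ne {z u : List A} (hz : Bad z)
    (h : ∀ s t : List A, z = s ++ u ++ t → s = [] ∨ t = []) : u ≠ [] := by
  rintro rfl
  have h2 := hz.two
  rcases z with _ | ⟨a, _ | ⟨b, z⟩⟩
  · simp at h2
  · simp at h2
  · have := h [a] (b :: z) (by simp)
    simp at this

theorem phi_ne (a : A) (t : List A) (h : phi a t = []) : t = [] := by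
  have := congrArg List.length h
  rw [phi_length] at this
  simp at this
  exact this.1

theorem bad_phi (a : A) (z' : List A) (hs : SepL a (phi a z' ++ [a]))
    (hb : Bad (phi a z' ++ [a])) : Bad z' := by
  obtain ⟨hnp, u, hu, hup, hus, hocc⟩ := id hb
  have hne := hb.border_ne hocc
  obtain ⟨r, c, rfl⟩ := (List.eq_nil_or_concat u).resolve_left hne
  rw [List.concat_eq_append] at *
  have hc : c = a := by
    obtain ⟨l, hl⟩ := hus
    rw [← List.append_assoc] at hl
    simpa using (List.append_inj' hl rfl).2
  subst hc
  have hhead : (r ++ [c]).head? = some c := by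
    obtain ⟨r', hr'⟩ := phi_head c z'
    rw [hr'] at hup
    rcases r with _ | ⟨d, r⟩
    · rfl
    · simp only [List.cons_append, List.cons_prefix_cons] at hup
      simp [hup.1]
  obtain ⟨u', rfl⟩ := phi_decode c r (hs.mono hup.isInfix) hhead
  refine ⟨fun h => hnp ((phi_pal _ _).2 h), u', (phi_pal _ _).1 hu, phi_prefix _ _ _ hup,
    phi_suffix _ _ _ hus, ?_⟩
  rintro s t rfl
  obtain ⟨r, hr⟩ := phi_head c t
  rcases hocc (phi c s) r (by
    rw [phi_append, phi_append]
    simp only [List.append_assoc]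
    rw [hr]; simp) with h | h
  · exact Or.inl (phi_ne _ _ h)
  · right
    subst h
    apply phi_ne c
    have := congrArg List.length hr
    simp at this
    exact this

theorem infix_wrap (w z : List A) (a b : A) (h : w <:+: a :: (z ++ [b])) :
    w <:+: z ∨ w <+: a :: (z ++ [b]) ∨ w <:+ a :: (z ++ [b]) := by
  obtain ⟨l, r, h⟩ := h
  rcases l with _ | ⟨c, l⟩
  · exact Or.inr (Or.inl ⟨r, by simpa using h⟩)
  rcases List.eq_nil_or_concat r with rfl | ⟨r, d, rfl⟩
  · exact Or.inr (Or.inr ⟨c :: l, by simpa using h⟩)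
  · left
    rw [List.concat_eq_append] at h
    simp only [List.cons_append, List.cons.injEq] at h
    have h2 := h.2
    rw [← List.append_assoc] at h2
    exact ⟨l, r, (List.append_inj' h2 rfl).1⟩

theorem phi_countP (a : A) (t : List A) :
    (phi a t).countP (fun y => decide (y ≠ a)) = t.countP (fun y => decide (y ≠ a)) := by
  induction t with
  | nil => rfl
  | cons y t ih =>
    by_cases h : y = a <;> simp [phi, h] at ih ⊢ <;> omega

theorem sep_wrap (a : A) (z : List A) (hs : SepL a z) : SepL a (a :: (z ++ [a])) := by
  intro y y' h
  rcases infix_wrap _ _ _ _ h with h | h | h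
  · exact hs _ _ h
  · rw [List.cons_prefix_cons] at h; exact Or.inl h.1
  · right
    obtain ⟨l, hl⟩ := h
    have : (l ++ [y]) ++ [y'] = (a :: z) ++ [a] := by simpa using hl
    simpa using (List.append_inj' this rfl).2

theorem TT_wrap (a b b' : A) (m m' z : List A) (hs : SepL a z) (ht : TT z) (e1 : z = b :: m)
    (e2 : z = m' ++ [b']) (hb : b ≠ a) (hb' : b' ≠ a) : TT (a :: (z ++ [a])) := by
  have hS := sep_wrap a z hs
  intro s x x' y y' hx hy h1 h2 h3 h4
  rcases s with _ | ⟨c, s⟩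
  · have q1 := hS x y h1
    have q2 := hS x y' h2
    have q3 := hS x' y h3
    have q4 := hS x' y' h4
    grind
  by_cases hc : c = a
  swap
  · have q1 := hS x c (List.IsInfix.trans ⟨[], s ++ [y], by simp⟩ h1)
    have q2 := hS x' c (List.IsInfix.trans ⟨[], s ++ [y], by simp⟩ h3)
    grind
  have hne : c :: s ≠ [] := by simp
  obtain ⟨s', d, hsd⟩ := (List.eq_nil_or_concat (c :: s)).resolve_left hne
  rw [List.concat_eq_append] at hsd
  by_cases hd : d = a
  swap
  · have q1 := hS d y (List.IsInfix.trans ⟨x :: s', [], by rw [hsd]; simp⟩ h1)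
    have q2 := hS d y' (List.IsInfix.trans ⟨x :: s', [], by rw [hsd]; simp⟩ h2)
    grind
  have key : ∀ x y : A, x :: ((c :: s) ++ [y]) <:+: a :: (z ++ [a]) →
      x :: ((c :: s) ++ [y]) <:+: z := by
    intro x y h
    rcases infix_wrap _ _ _ _ h with h | h | h
    · exact h
    · exfalso
      rw [e1] at h
      simp only [List.cons_append, List.cons_prefix_cons] at h
      exact hb (h.2.1.symm.trans hc)
    · exfalso
      rw [e2, hsd] at h
      obtain ⟨l, hl⟩ := h
      have hl2 : (l ++ x :: s') ++ [d, y] = (a :: m') ++ [b', a] := by simpa using hl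
      have := (List.append_inj' hl2 rfl).2
      simp only [List.cons.injEq] at this
      exact hb' (this.1.symm.trans hd)
  exact ht _ x x' y y' hx hy (key _ _ h1) (key _ _ h2) (key _ _ h3) (key _ _ h4)

theorem step (a : A) (z : List A) (hs : SepL a z) (ht : TT z) (hb : Bad z) :
    ∃ z' : List A, z'.length < z.length ∧ TT z' ∧ Bad z' ∧ (∀ y ∈ z', y ∈ z) ∧
      (¬ [a, a] <:+: z → a ∉ z') := by
  obtain ⟨hnp, u, hu, hup, hus, hocc⟩ := id hb
  have hne := hb.border_ne hocc
  have h2 := hb.two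
  obtain ⟨b, u1, hu1⟩ : ∃ b u1, u = b :: u1 := List.exists_cons_of_ne_nil hne
  have hu2 : u = u1.reverse ++ [b] := by rw [← hu, hu1]; simp
  obtain ⟨r, hr⟩ := hup
  obtain ⟨l, hl⟩ := hus
  have e1 : z = b :: (u1 ++ r) := by rw [← hr, hu1]; simp
  have e2 : z = (l ++ u1.reverse) ++ [b] := by rw [← hl, hu2]; simp
  by_cases hba : b = a
  · subst hba
    obtain ⟨z', hz'⟩ := phi_decode b (l ++ u1.reverse) (by rw [← e2]; exact hs)
      (by rw [← e2, e1]; rfl)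
    rw [hz'] at e2
    rw [e2] at hs ht hb
    refine ⟨z', ?_, phi_TT _ _ ht, bad_phi _ _ hs hb, ?_, ?_⟩
    · rw [e2, List.length_append, phi_length]; simp only [List.length_singleton]; omega
    · intro y hy; rw [e2]; simp [phi_mem b z' y hy]
    · intro h h'; apply h; rw [e2]; exact phi_aa _ _ h'
  · have hS := sep_wrap a z hs
    have hT := TT_wrap a b b _ _ z hs ht e1 e2 hba hba
    have hzu : z ≠ u := by rintro rfl; exact hnp hu
    have hBad : Bad (a :: (z ++ [a])) := by
      refine ⟨?_, a :: (u ++ [a]), by simp [hu], ?_, ?_, ?_⟩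
      · intro h; apply hnp; simpa using h
      · rcases r with _ | ⟨c, r⟩
        · exact absurd (by simpa using hr.symm) hzu
        · have := hs b c ⟨u1.reverse, r, by rw [← hr, hu2]; simp⟩
          have hc : c = a := by tauto
          exact ⟨r ++ [a], by rw [← hr, hc]; simp⟩
      · rcases List.eq_nil_or_concat l with rfl | ⟨l, c, rfl⟩
        · exact absurd (by simpa using hl.symm) hzu
        · rw [List.concat_eq_append] at hl
          have := hs c b ⟨l, u1, by rw [← hl, hu1]; simp⟩
          have hc : c = a := by tauto
          exact ⟨a :: l, by rw [← hl, hc]; simp⟩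
      · intro s t h
        rcases s with _ | ⟨c, s⟩
        · exact Or.inl rfl
        rcases List.eq_nil_or_concat t with rfl | ⟨t, d, rfl⟩
        · exact Or.inr rfl
        exfalso
        rw [List.concat_eq_append] at h
        simp only [List.cons_append, List.cons.injEq] at h
        have h' := h.2
        rw [← List.append_assoc] at h'
        have := hocc (s ++ [a]) ([a] ++ t) (by rw [(List.append_inj' h' rfl).1]; simp)
        simp at this
    obtain ⟨z', hz'⟩ := phi_decode a (a :: z) hS rfl
    have haz : a ∈ z := by
      rcases hm : u1 ++ r with _ | ⟨c, m⟩
      · rw [hm] at e1; rw [e1] at h2; simp at h2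
      · have := hs b c ⟨[], m, by rw [e1, hm]; simp⟩
        have hc : c = a := by tauto
        rw [e1, hm, hc]; simp
    rw [← List.cons_append, hz'] at hT hBad hS
    have hcount : 2 ≤ z'.countP (fun y => decide (y ≠ a)) := by
      rw [← phi_countP, ← hz', e1]
      rcases List.eq_nil_or_concat (u1 ++ r) with h | ⟨m, d, h⟩
      · rw [h] at e1; rw [e1] at h2; simp at h2
      · rw [List.concat_eq_append] at h
        have : d = b := by
          rw [e1, h, ← List.cons_append] at e2
          simpa using (List.append_inj' e2 rfl).2
        rw [h, this]
        simp [hba]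
    refine ⟨z', ?_, phi_TT _ _ hT, bad_phi _ _ hS hBad, ?_, ?_⟩
    · have := congrArg List.length hz'
      rw [phi_length] at this
      simp only [List.length_cons] at this
      omega
    · intro y hy
      have := phi_mem a z' y hy
      rw [← hz'] at this
      rcases List.mem_cons.1 this with rfl | h
      · exact haz
      · exact h
    · intro h h'
      have := phi_aa a z' h'
      rw [← hz'] at this
      rcases infix_wrap _ _ _ _ this with h3 | h3 | h3
      · exact h h3
      · rw [e1] at h3
        simp only [List.cons_append, List.cons_prefix_cons] at h3
        exact hba h3.2.1.symm
      · rw [e2] at h3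
        obtain ⟨l', hl'⟩ := h3
        have hl2 : l' ++ [a, a] = (a :: (l ++ u1.reverse)) ++ [b, a] := by simpa using hl'
        have := (List.append_inj' hl2 rfl).2
        simp only [List.cons.injEq] at this
        exact hba this.1.symm

/-- A word without changes of letter is constant. -/
theorem const_of_no_change (c : A) (t : List A) (h : ∀ y z : A, [y, z] <:+: c :: t → y = c → z = c) :
    ∀ y ∈ c :: t, y = c := by
  induction t with
  | nil => simp
  | cons d t ih =>
    have hd : d = c := h c d ⟨[], t, by simp⟩ rfl
    subst hd
    have := ih (fun y z hyz => h y z (hyz.trans ⟨[d], [], by simp⟩))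
    intro y hy
    rcases List.mem_cons.1 hy with rfl | hy
    · rfl
    · exact this y hy

theorem pal_of_const (c : A) (t : List A) (h : ∀ y ∈ t, y = c) : t.reverse = t := by
  rw [List.eq_replicate_iff.2 ⟨rfl, h⟩]; simp

theorem not_bad_two (c d : A) (n : ℕ) : ∀ z : List A, z.length = n → (∀ y ∈ z, y = c ∨ y = d) →
    TT z → ¬ Bad z := by
  induction n using Nat.strong_induction_on with
  | _ n ih =>
    intro z hn hcd ht hb
    have viaSep : ∀ a : A, SepL a z → False := by
      intro a ha
      obtain ⟨z', h1, h2, h3, h4, -⟩ := step a z ha ht hb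
      exact ih _ (hn ▸ h1) z' rfl (fun y hy => hcd y (h4 y hy)) h2 h3
    have mem2 : ∀ y y' : A, [y, y'] <:+: z → (y = c ∨ y = d) ∧ (y' = c ∨ y' = d) := fun y y' h =>
      ⟨hcd y (h.subset (by simp)), hcd y' (h.subset (by simp))⟩
    by_cases hne : c = d
    · subst hne
      exact hb.1 (pal_of_const c z (fun y hy => by simpa using hcd y hy))
    by_cases h1 : [c, c] <:+: z
    swap
    · apply viaSep d
      intro y y' h
      have := mem2 y y' h
      grind
    by_cases h2 : [d, d] <:+: z
    swap
    · apply viaSep c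
      intro y y' h
      have := mem2 y y' h
      grind
    -- the first and last letters coincide
    obtain ⟨hnp, u, hu, hup, hus, hocc⟩ := id hb
    have hune := hb.border_ne hocc
    obtain ⟨b, u1, hu1⟩ : ∃ b u1, u = b :: u1 := List.exists_cons_of_ne_nil hune
    have hu2 : u = u1.reverse ++ [b] := by rw [← hu, hu1]; simp
    obtain ⟨r, hr⟩ := hup
    obtain ⟨l, hl⟩ := hus
    have e1 : z = b :: (u1 ++ r) := by rw [← hr, hu1]; simp
    have e2 : z.reverse = b :: (u1 ++ l.reverse) := by rw [← hl, hu2]; simp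
    have hbz : b = c ∨ b = d := hcd b (by rw [e1]; simp)
    have hout : ∃ y z' : A, [y, z'] <:+: z ∧ y = b ∧ z' ≠ b := by
      by_contra hcon
      push Not at hcon
      apply hnp
      apply pal_of_const b
      rw [e1]
      apply const_of_no_change
      rw [← e1]
      exact hcon
    have hin : ∃ y z' : A, [z', y] <:+: z ∧ y = b ∧ z' ≠ b := by
      by_contra hcon
      push Not at hcon
      apply hnp
      rw [eq_comm]
      conv_lhs => rw [← List.reverse_reverse z]
      apply pal_of_const b
      rw [e2]
      apply const_of_no_change
      rw [← e2]
      intro y z' h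
      exact hcon y z' (by rw [← List.reverse_infix]; simpa using h)
    obtain ⟨y, y', o1, rfl, o3⟩ := hout
    obtain ⟨y0, x', i1, hy0, i3⟩ := hin
    subst hy0
    have m1 := mem2 _ _ o1
    have m2 := mem2 _ _ i1
    have : x' = y' := by grind
    subst this
    have hyy : [y0, y0] <:+: z := by rcases hbz with rfl | rfl <;> assumption
    have hxx : [x', x'] <:+: z := by
      have : x' = c ∨ x' = d := m1.2
      rcases this with rfl | rfl <;> assumption
    exact ht [] y0 x' y0 x' o3.symm o3.symm hyy o1 i1 hxx

theorem rich_two (c d : A) (v : List A) (h : ∀ y ∈ v, y = c ∨ y = d) (ht : TT v) : Rich v :=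
  rich_of_not_bad v (fun z hz => not_bad_two c d _ z rfl (fun y hy => h y (hz.subset hy)) (ht.mono hz))

theorem rich_three (a b c : A) (v : List A) (h : ∀ y ∈ v, y = a ∨ y = b ∨ y = c) (ht : TT v)
    (hs : SepL b v) (hbb : ¬ [b, b] <:+: v) : Rich v := by
  apply rich_of_not_bad
  intro z hz hb
  obtain ⟨z', h1, h2, h3, h4, h5⟩ := step b z (hs.mono hz) (ht.mono hz) hb
  have hbz := h5 (fun h => hbb (h.trans hz))
  refine not_bad_two a c _ z' rfl ?_ h2 h3
  intro y hy
  rcases h y (hz.subset (h4 y hy)) with h | h | h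
  · exact Or.inl h
  · subst h; exact absurd hy hbz
  · exact Or.inr h

/-! ### Growth implies no strong bispecial factors -/

/-- `s` is strongly bispecial in `v`. -/
def Strong (v s : List A) : Prop := ∃ x x' y y' : A, x ≠ x' ∧ y ≠ y' ∧ x :: (s ++ [y]) <:+: v ∧
  x :: (s ++ [y']) <:+: v ∧ x' :: (s ++ [y]) <:+: v ∧ x' :: (s ++ [y']) <:+: v

theorem lcs_split (u s : List A) (hl : u.length = s.length) (hne : u ≠ s) :
    ∃ (u1 s1 t : List A) (x y : A), u = u1 ++ x :: t ∧ s = s1 ++ y :: t ∧ x ≠ y := by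
  induction u generalizing s with
  | nil =>
    exfalso; apply hne
    symm; apply List.length_eq_zero_iff.1; simpa using hl.symm
  | cons x u ih =>
    rcases s with _ | ⟨y, s⟩
    · simp at hl
    · by_cases h : u = s
      · subst h
        exact ⟨[], [], u, x, y, rfl, rfl, by rintro rfl; exact hne rfl⟩
      · obtain ⟨u1, s1, t, x', y', h1, h2, h3⟩ := ih s (by simpa using hl) h
        exact ⟨x :: u1, y :: s1, t, x', y', by simp [h1], by simp [h2], h3⟩

theorem count_aux (v τ1 τ2 : List A) (m : ℕ) (c d : A) (hcd : c ≠ d) (hτ : τ1 ≠ τ2)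
    (hl1 : τ1.length = m) (hl2 : τ2.length = m)
    (h1c : τ1 ++ [c] <:+: v) (h1d : τ1 ++ [d] <:+: v)
    (h2c : τ2 ++ [c] <:+: v) (h2d : τ2 ++ [d] <:+: v)
    (hext : ∀ τ : List A, τ <:+: v → τ.length = m → ∃ g, τ ++ [g] <:+: v) :
    C v m + 2 ≤ C v (m + 1) := by
  classical
  have hg : ∀ τ : List A, ∃ g : A, τ <:+: v → τ.length = m → τ ++ [g] <:+: v := by
    intro τ
    by_cases h : τ <:+: v ∧ τ.length = m
    · obtain ⟨g, hg⟩ := hext τ h.1 h.2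
      exact ⟨g, fun _ _ => hg⟩
    · exact ⟨c, fun a b => absurd ⟨a, b⟩ h⟩
  choose g hg using hg
  have ho : ∀ τ : List A, ∃ o : A, o ≠ g τ ∧ (o = c ∨ o = d) := by
    intro τ
    by_cases h : g τ = c
    · exact ⟨d, by rw [h]; exact hcd.symm, Or.inr rfl⟩
    · exact ⟨c, fun h' => h h'.symm, Or.inl rfl⟩
  choose o ho1 ho2 using ho
  have hinj : Function.Injective (fun τ : List A => τ ++ [g τ]) := by
    intro a b h
    exact (List.append_inj' h rfl).1
  have hnot : ∀ τ, τ ++ [o τ] ∉ (facLen v m).image (fun τ : List A => τ ++ [g τ]) := by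
    intro τ h
    obtain ⟨τ', -, h⟩ := Finset.mem_image.1 h
    have h' := List.append_inj' h rfl
    have := h'.1
    subst this
    have h2 := h'.2
    simp only [List.cons.injEq, and_true] at h2
    exact ho1 _ h2.symm
  have hsub : insert (τ1 ++ [o τ1]) (insert (τ2 ++ [o τ2])
      ((facLen v m).image (fun τ : List A => τ ++ [g τ]))) ⊆ facLen v (m + 1) := by
    intro u hu
    simp only [Finset.mem_insert, Finset.mem_image, mem_facLen] at hu
    rw [mem_facLen]
    rcases hu with rfl | rfl | ⟨τ, ⟨a, b⟩, rfl⟩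
    · refine ⟨?_, by simp [hl1]⟩
      rcases ho2 τ1 with h | h <;> rw [h] <;> assumption
    · refine ⟨?_, by simp [hl2]⟩
      rcases ho2 τ2 with h | h <;> rw [h] <;> assumption
    · exact ⟨hg τ a b, by simp [b]⟩
  have := Finset.card_le_card hsub
  rw [Finset.card_insert_of_notMem, Finset.card_insert_of_notMem (hnot τ2),
    Finset.card_image_of_injective _ hinj] at this
  · rw [C_eq, C_eq]; omega
  · rw [Finset.mem_insert, not_or]
    refine ⟨fun h => hτ (List.append_inj' h rfl).1, hnot τ1⟩

theorem last_of_append (w : List A) (n : ℕ) (hn : n ≤ w.length) :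
    ∃ l σ : List A, w = l ++ σ ∧ σ.length = n :=
  ⟨w.take (w.length - n), w.drop (w.length - n), by simp, by simp; omega⟩

theorem ext_suffix (v s : List A) (c d : A) (n : ℕ) (hn : 1 ≤ n) (hs : s.length = n)
    (hV : ∀ y z z' : A, [y, z] <:+: v → [y, z'] <:+: v → z ≠ z' → (z = c ∧ z' = d) ∨ (z = d ∧ z' = c))
    (hV' : ∀ y z z' : A, [z, y] <:+: v → [z', y] <:+: v → z ≠ z' →
      (z = c ∧ z' = d) ∨ (z = d ∧ z' = c))
    (hne : c ≠ d)
    (hcc : c :: (s ++ [c]) <:+: v) (hcd : c :: (s ++ [d]) <:+: v)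
    (hdc : d :: (s ++ [c]) <:+: v) (hdd : d :: (s ++ [d]) <:+: v)
    (hU : ∀ (u : List A) (z z' : A), u ≠ s → u.length = n → u ++ [z] <:+: v → u ++ [z'] <:+: v →
      z = z') :
    ∃ (σ : List A) (g : A), σ <:+ v ∧ σ.length = n + 1 ∧ σ ++ [g] <:+: v := by
  obtain ⟨e1, s0, hs0⟩ : ∃ e1 s0, s = e1 :: s0 :=
    List.exists_cons_of_ne_nil (by rintro rfl; simp at hs; omega)
  obtain ⟨s9, e9, hs9⟩ := (List.eq_nil_or_concat s).resolve_left (by rintro rfl; simp at hs; omega)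
  rw [List.concat_eq_append] at hs9
  have hsv : s <:+: v := List.IsInfix.trans ⟨[c], [c], by simp⟩ hcc
  obtain ⟨P, Q, hPQ, hmin⟩ := exists_last_occ v s hsv
  rcases Q with _ | ⟨e, ρ⟩
  · rw [List.append_nil] at hPQ
    rcases List.eq_nil_or_concat P with rfl | ⟨P0, e, rfl⟩
    · have := hcc.length_le
      rw [hPQ] at this
      simp at this
    · rw [List.concat_eq_append] at hPQ
      have he : e = c ∨ e = d := by
        by_contra h
        push Not at h
        have := hV' e1 e c ⟨P0, s0, by rw [hPQ, hs0]; simp⟩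
          (List.IsInfix.trans ⟨[], s0 ++ [c], by rw [hs0]; simp⟩ hcc) h.1
        tauto
      refine ⟨e :: s, c, ⟨P0, by rw [hPQ]; simp⟩, by simp [hs], ?_⟩
      rcases he with rfl | rfl
      · exact hcc
      · exact hdc
  · have he : e = c ∨ e = d := by
      by_contra h
      push Not at h
      have := hV e9 e c ⟨P ++ s9, ρ, by rw [hPQ, hs9]; simp⟩
        (List.IsInfix.trans ⟨c :: s9, [], by rw [hs9]; simp⟩ hcc) h.1
      tauto
    have hother : ∃ P' Q' : List A, v = P' ++ s ++ e :: Q' ∧ P' ≠ P := by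
      have h1 : c :: (s ++ [e]) <:+: v := by rcases he with rfl | rfl <;> assumption
      have h2 : d :: (s ++ [e]) <:+: v := by rcases he with rfl | rfl <;> assumption
      obtain ⟨P1, Q1, h1⟩ := h1
      obtain ⟨P2, Q2, h2⟩ := h2
      by_cases h : P1 ++ [c] = P
      · refine ⟨P2 ++ [d], Q2, by rw [← h2]; simp, ?_⟩
        rw [← h]
        intro h'
        have := (List.append_inj' h' rfl).2
        simp only [List.cons.injEq, and_true] at this
        exact hne this.symm
      · exact ⟨P1 ++ [c], Q1, by rw [← h1]; simp, h⟩
    obtain ⟨P', Q', hPQ', hPne⟩ := hother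
    have hlen : ρ.length < Q'.length := by
      have h1 := hmin P' (e :: Q') hPQ'
      simp only [List.length_cons] at h1
      rcases Nat.lt_or_ge ρ.length Q'.length with h | h
      · exact h
      · exfalso
        apply hPne
        have hl : Q'.length = ρ.length := by omega
        rw [hPQ] at hPQ'
        have h2 := List.append_inj' hPQ' (by simp [hl])
        exact (List.append_inj' h2.1 rfl).1.symm
    have hdet : ∀ ρ1 : List A, ρ1 <+: ρ → ρ1 <+: Q' := by
      intro ρ1
      induction ρ1 using List.reverseRecOn with
      | nil => simp
      | append_singleton ρ1 f ih =>
        intro hpre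
        obtain ⟨R1, hR1⟩ := hpre
        obtain ⟨Q2, hQ2⟩ := ih ⟨[f] ++ R1, by rw [← hR1]; simp⟩
        rcases Q2 with _ | ⟨f', Q3⟩
        · rw [← hQ2, ← hR1] at hlen
          simp at hlen
        · obtain ⟨l, ω, hω, hωl⟩ := last_of_append (s ++ e :: ρ1) n (by simp; omega)
          have hωs : ω ≠ s := by
            rintro rfl
            have := hmin (P ++ l) (f :: R1) (by
              rw [hPQ, ← hR1, List.append_assoc P l, ← hω]; simp)
            rw [← hR1] at this
            simp at this
            omega
          have hff := hU ω f f' hωs hωl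
            ⟨P ++ l, R1, by
              have : P ++ l ++ (ω ++ [f]) ++ R1 = P ++ (l ++ ω) ++ f :: R1 := by simp
              rw [this, ← hω, hPQ, ← hR1]; simp⟩
            ⟨P' ++ l, Q3, by
              have : P' ++ l ++ (ω ++ [f']) ++ Q3 = P' ++ (l ++ ω) ++ f' :: Q3 := by simp
              rw [this, ← hω, hPQ', ← hQ2]; simp⟩
          exact ⟨Q3, by rw [← hQ2, hff]; simp⟩
    obtain ⟨Q2, hQ2⟩ := hdet ρ List.prefix_rfl
    rcases Q2 with _ | ⟨g, Q3⟩
    · rw [← hQ2] at hlen; simp at hlen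
    · obtain ⟨l, σ, hσ, hσl⟩ := last_of_append (s ++ e :: ρ) (n + 1) (by simp; omega)
      refine ⟨σ, g, ⟨P ++ l, ?_⟩, hσl, ⟨P' ++ l, Q3, ?_⟩⟩
      · rw [List.append_assoc, ← hσ, hPQ]; simp
      · have : P' ++ l ++ (σ ++ [g]) ++ Q3 = P' ++ (l ++ σ) ++ g :: Q3 := by simp
        rw [this, ← hσ, hPQ', ← hQ2]; simp

theorem TT_of_grow (v : List A) (c d : A) (hg : Grow v)
    (hV : ∀ y z z' : A, [y, z] <:+: v → [y, z'] <:+: v → z ≠ z' → (z = c ∧ z' = d) ∨ (z = d ∧ z' = c))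
    (hV' : ∀ y z z' : A, [z, y] <:+: v → [z', y] <:+: v → z ≠ z' →
      (z = c ∧ z' = d) ∨ (z = d ∧ z' = c))
    (h0 : ¬ Strong v []) : TT v := by
  have main : ∀ n : ℕ, ∀ s : List A, s.length = n → ¬ Strong v s := by
    intro n
    induction n using Nat.strong_induction_on with
    | _ n ih =>
      rintro s hs ⟨x, x', y, y', hx, hy, h1, h2, h3, h4⟩
      rcases Nat.eq_zero_or_pos n with hn | hn
      · have : s = [] := List.length_eq_zero_iff.1 (by omega)
        subst this
        exact h0 ⟨x, x', y, y', hx, hy, h1, h2, h3, h4⟩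
      obtain ⟨e1, s0, hs0⟩ : ∃ e1 s0, s = e1 :: s0 :=
        List.exists_cons_of_ne_nil (by rintro rfl; simp at hs; omega)
      obtain ⟨s9, e9, hs9⟩ :=
        (List.eq_nil_or_concat s).resolve_left (by rintro rfl; simp at hs; omega)
      rw [List.concat_eq_append] at hs9
      have hxx := hV' e1 x x' (List.IsInfix.trans ⟨[], s0 ++ [y], by rw [hs0]; simp⟩ h1)
        (List.IsInfix.trans ⟨[], s0 ++ [y], by rw [hs0]; simp⟩ h3) hx
      have hyy := hV e9 y y' (List.IsInfix.trans ⟨x :: s9, [], by rw [hs9]; simp⟩ h1)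
        (List.IsInfix.trans ⟨x :: s9, [], by rw [hs9]; simp⟩ h2) hy
      have hall : c ≠ d ∧ c :: (s ++ [c]) <:+: v ∧ c :: (s ++ [d]) <:+: v ∧
          d :: (s ++ [c]) <:+: v ∧ d :: (s ++ [d]) <:+: v := by
        rcases hxx with ⟨rfl, rfl⟩ | ⟨rfl, rfl⟩ <;> rcases hyy with ⟨rfl, rfl⟩ | ⟨rfl, rfl⟩ <;>
          first
          | exact ⟨hx, by assumption, by assumption, by assumption, by assumption⟩
          | exact ⟨hx.symm, by assumption, by assumption, by assumption, by assumption⟩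
      obtain ⟨hne, hcc, hcd, hdc, hdd⟩ := hall
      have hU : ∀ (u : List A) (z z' : A), u ≠ s → u.length = n → u ++ [z] <:+: v →
          u ++ [z'] <:+: v → z = z' := by
        intro u z z' hus hul hz hz'
        by_contra hzz
        obtain ⟨u9, f9, hu9⟩ :=
          (List.eq_nil_or_concat u).resolve_left (by rintro rfl; simp at hul; omega)
        rw [List.concat_eq_append] at hu9
        have hzc := hV f9 z z' (List.IsInfix.trans ⟨u9, [], by rw [hu9]; simp⟩ hz)
          (List.IsInfix.trans ⟨u9, [], by rw [hu9]; simp⟩ hz') hzz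
        have huc : u ++ [c] <:+: v ∧ u ++ [d] <:+: v := by
          rcases hzc with ⟨rfl, rfl⟩ | ⟨rfl, rfl⟩ <;> exact ⟨by assumption, by assumption⟩
        obtain ⟨u1, s1, t, α, β, hu, hs', hαβ⟩ := lcs_split u s (by omega) hus
        refine ih t.length ?_ t rfl ⟨α, β, c, d, hαβ, hne, ?_, ?_, ?_, ?_⟩
        · have := congrArg List.length hs'
          simp at this; omega
        · exact List.IsInfix.trans ⟨u1, [], by rw [hu]; simp⟩ huc.1
        · exact List.IsInfix.trans ⟨u1, [], by rw [hu]; simp⟩ huc.2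
        · exact List.IsInfix.trans ⟨c :: s1, [], by rw [hs']; simp⟩ hcc
        · exact List.IsInfix.trans ⟨c :: s1, [], by rw [hs']; simp⟩ hcd
      obtain ⟨σ, g, hσ, hσl, hσg⟩ :=
        ext_suffix v s c d n hn hs hV hV' hne hcc hcd hdc hdd hU
      have := count_aux v (c :: s) (d :: s) (n + 1) c d hne (by simp [hne]) (by simp [hs])
        (by simp [hs]) hcc hcd hdc hdd (by
          rintro τ ⟨l, r, hτ⟩ hτl
          rcases r with _ | ⟨g', r⟩
          · have hτs : τ <:+ v := ⟨l, by simpa using hτ⟩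
            have : τ = σ := (List.suffix_of_suffix_length_le hτs hσ (by omega)).eq_of_length
              (by omega)
            exact ⟨g, this ▸ hσg⟩
          · exact ⟨g', l, r, by rw [← hτ]; simp⟩)
      have := hg (n + 1) (by omega)
      omega
  intro s x x' y y' hx hy h1 h2 h3 h4
  exact main _ s rfl ⟨x, x', y, y', hx, hy, h1, h2, h3, h4⟩

/-! ### The core argument -/

theorem edge_lemma (p : List A) (hp : p ≠ []) : ∃ E : Finset (List A),
    (∀ e ∈ E, ∃ y z : A, e = [y, z] ∧ y ≠ z ∧ ([y, z] <:+: p ∨ [z, y] <:+: p)) ∧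
      2 * (Alph p).card ≤ E.card + 2 := by
  induction p with
  | nil => exact absurd rfl hp
  | cons y t ih =>
    rcases t with _ | ⟨z, t⟩
    · exact ⟨∅, by simp, by simp [Alph]⟩
    · obtain ⟨E, hE, hc⟩ := ih (by simp)
      by_cases hy : y ∈ z :: t
      · refine ⟨E, ?_, ?_⟩
        · intro e he
          obtain ⟨y', z', h1, h2, h3⟩ := hE e he
          refine ⟨y', z', h1, h2, ?_⟩
          rcases h3 with h | h
          · exact Or.inl (h.trans ⟨[y], [], by simp⟩)
          · exact Or.inr (h.trans ⟨[y], [], by simp⟩)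
        · have : Alph (y :: z :: t) = Alph (z :: t) := by
            unfold Alph
            rw [List.toFinset_cons]
            exact Finset.insert_eq_of_mem (List.mem_toFinset.2 hy)
          rw [this]; exact hc
      · have hyz : y ≠ z := by rintro rfl; simp at hy
        have hlet : ∀ e ∈ E, y ∉ e := by
          intro e he hye
          obtain ⟨y', z', h1, h2, h3⟩ := hE e he
          apply hy
          rw [h1] at hye
          rcases h3 with h | h
          · exact h.subset hye
          · exact h.subset (by simp at hye ⊢; tauto)
        refine ⟨insert [y, z] (insert [z, y] E), ?_, ?_⟩
        · intro e he
          simp only [Finset.mem_insert] at he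
          rcases he with rfl | rfl | he
          · exact ⟨y, z, rfl, hyz, Or.inl ⟨[], t, by simp⟩⟩
          · exact ⟨z, y, rfl, hyz.symm, Or.inr ⟨[], t, by simp⟩⟩
          · obtain ⟨y', z', h1, h2, h3⟩ := hE e he
            refine ⟨y', z', h1, h2, ?_⟩
            rcases h3 with h | h
            · exact Or.inl (h.trans ⟨[y], [], by simp⟩)
            · exact Or.inr (h.trans ⟨[y], [], by simp⟩)
        · have h1 : (Alph (y :: z :: t)).card = (Alph (z :: t)).card + 1 := by
            unfold Alph
            rw [List.toFinset_cons, Finset.card_insert_of_notMem]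
            rwa [List.mem_toFinset]
          rw [h1, Finset.card_insert_of_notMem, Finset.card_insert_of_notMem]
          · omega
          · intro h; exact hlet _ h (by simp)
          · rw [Finset.mem_insert, not_or]
            exact ⟨by simp [hyz], fun h => hlet _ h (by simp)⟩

/-- Edges for palindromes: both orientations occur. -/
theorem edge_pal (p : List A) (hp : p ≠ []) (hpal : p.reverse = p) : ∃ E : Finset (List A),
    (∀ e ∈ E, ∃ y z : A, e = [y, z] ∧ y ≠ z ∧ [y, z] <:+: p ∧ [z, y] <:+: p) ∧
      2 * (Alph p).card ≤ E.card + 2 := by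
  obtain ⟨E, hE, hc⟩ := edge_lemma p hp
  refine ⟨E, fun e he => ?_, hc⟩
  have hrev : ∀ y z : A, [y, z] <:+: p → [z, y] <:+: p := by
    intro y z h
    rw [← hpal, ← List.reverse_infix]; simpa using h
  obtain ⟨y, z, h1, h2, h3⟩ := hE e he
  rcases h3 with h | h
  · exact ⟨y, z, h1, h2, h, hrev _ _ h⟩
  · exact ⟨y, z, h1, h2, hrev _ _ h, h⟩

theorem rich_tri (v : List A) (a b c : A) (hg : Grow v) (hac : a ≠ c) (hab : a ≠ b) (hbc : b ≠ c)
    (hall : ∀ y ∈ v, y = a ∨ y = b ∨ y = c) (hd : ∀ y z : A, [y, z] <:+: v → y ≠ z)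
    (h1 : ¬ [a, c] <:+: v) (h2 : ¬ [c, a] <:+: v) : Rich v := by
  have hmem : ∀ y z : A, [y, z] <:+: v → (y = a ∨ y = b ∨ y = c) ∧ (z = a ∨ z = b ∨ z = c) :=
    fun y z h => ⟨hall y (h.subset (by simp)), hall z (h.subset (by simp))⟩
  have hsep : ∀ y z : A, [y, z] <:+: v → (y = b ∧ z ≠ b) ∨ (y ≠ b ∧ z = b) := by
    intro y z h
    have h3 := hd y z h
    obtain ⟨h4, h5⟩ := hmem y z h
    rcases h4 with rfl | rfl | rfl <;> rcases h5 with rfl | rfl | rfl <;>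
      first | exact absurd rfl h3 | exact absurd h h1 | exact absurd h h2 | tauto
  refine rich_three a b c v hall ?_ ?_ ?_
  · refine TT_of_grow v a c hg ?_ ?_ ?_
    · intro y z z' h h' hz
      have := hsep _ _ h; have := hsep _ _ h'; have := hmem _ _ h; have := hmem _ _ h'
      grind
    · intro y z z' h h' hz
      have := hsep _ _ h; have := hsep _ _ h'; have := hmem _ _ h; have := hmem _ _ h'
      grind
    · rintro ⟨x, x', y, y', hx, hy, q1, q2, q3, q4⟩
      have := hsep _ _ q1; have := hsep _ _ q2; have := hsep _ _ q3; have := hsep _ _ q4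
      have := hmem _ _ q1; have := hmem _ _ q4
      grind
  · intro y z h
    have := hsep y z h
    tauto
  · intro h
    exact hd b b h rfl

theorem core_rich (v p : List A) (hg : Grow v) (hpv : p <:+: v) (hp : p ≠ []) (hpal : p.reverse = p)
    (hal : ∀ y ∈ v, y ∈ p) : Rich v := by
  classical
  obtain ⟨E, hE, hc⟩ := edge_pal p hp hpal
  have hA : Alph v = Alph p := by
    ext y
    simp only [Alph, List.mem_toFinset]
    exact ⟨hal y, fun h => hpv.subset h⟩
  have hsub : E ⊆ facLen v 2 := by
    intro e he
    obtain ⟨y, z, h1, h2, h3, h4⟩ := hE e he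
    rw [mem_facLen, h1]
    exact ⟨h3.trans hpv, rfl⟩
  have hle := Finset.card_le_card hsub
  have hgr := hg 1 le_rfl
  rw [C_one, C_eq, hA] at hgr
  have hpos : 0 < (Alph p).card := by
    rw [Finset.card_pos]
    obtain ⟨y, t, rfl⟩ := List.exists_cons_of_ne_nil hp
    exact ⟨y, by simp [Alph]⟩
  have hmemA : ∀ y ∈ v, y ∈ Alph p := fun y hy => by simpa [Alph] using hal y hy
  have h3 : (Alph p).card = 1 ∨ (Alph p).card = 2 ∨ (Alph p).card = 3 := by
    have : 1 + 1 = 2 := rfl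
    rw [this] at hgr
    omega
  by_cases hk : (Alph p).card = 3
  · have heq : E = facLen v 2 := Finset.eq_of_subset_of_card_le hsub (by
      have : 1 + 1 = 2 := rfl
      rw [this] at hgr
      omega)
    have hfac : ∀ y z : A, [y, z] <:+: v → y ≠ z ∧ [z, y] <:+: v := by
      intro y z h
      have : [y, z] ∈ E := by rw [heq, mem_facLen]; exact ⟨h, rfl⟩
      obtain ⟨y', z', h1, h2, h3, h4⟩ := hE _ this
      simp only [List.cons.injEq, and_true] at h1
      obtain ⟨rfl, rfl⟩ := h1
      exact ⟨h2, h4.trans hpv⟩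
    obtain ⟨a, b, c, hab, hac, hbc, habc⟩ := Finset.card_eq_three.1 hk
    have hall : ∀ y ∈ v, y = a ∨ y = b ∨ y = c := by
      intro y hy
      have := hmemA y hy
      rw [habc] at this
      simpa using this
    by_cases q1 : [a, c] <:+: v
    swap
    · exact rich_tri v a b c hg hac hab hbc hall (fun y z h => (hfac y z h).1) q1
        (fun h => q1 (hfac _ _ h).2)
    by_cases q2 : [a, b] <:+: v
    swap
    · exact rich_tri v a c b hg hab hac hbc.symm (fun y hy => by have := hall y hy; tauto)
        (fun y z h => (hfac y z h).1) q2 (fun h => q2 (hfac _ _ h).2)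
    by_cases q3 : [b, c] <:+: v
    swap
    · exact rich_tri v b a c hg hbc hab.symm hac (fun y hy => by have := hall y hy; tauto)
        (fun y z h => (hfac y z h).1) q3 (fun h => q3 (hfac _ _ h).2)
    exfalso
    have hsix : ({[a, c], [c, a], [a, b], [b, a], [b, c]} : Finset (List A)) ⊆ facLen v 2 := by
      intro e he
      simp only [Finset.mem_insert, Finset.mem_singleton] at he
      rw [mem_facLen]
      rcases he with rfl | rfl | rfl | rfl | rfl
      · exact ⟨q1, rfl⟩
      · exact ⟨(hfac _ _ q1).2, rfl⟩
      · exact ⟨q2, rfl⟩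
      · exact ⟨(hfac _ _ q2).2, rfl⟩
      · exact ⟨q3, rfl⟩
    have h5 := Finset.card_le_card hsix
    have h6 : ({[a, c], [c, a], [a, b], [b, a], [b, c]} : Finset (List A)).card = 5 := by
      simp [Finset.card_insert_of_notMem, hab, hac, hbc, hab.symm, hac.symm, hbc.symm]
    have : 1 + 1 = 2 := rfl
    rw [this] at hgr
    omega
  · have hcd : ∃ c d : A, ∀ y ∈ v, y = c ∨ y = d := by
      rcases h3 with h | h | h
      · obtain ⟨c, hc⟩ := Finset.card_eq_one.1 h
        refine ⟨c, c, fun y hy => ?_⟩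
        have := hmemA y hy
        rw [hc] at this
        simpa using this
      · obtain ⟨c, d, -, hc⟩ := Finset.card_eq_two.1 h
        refine ⟨c, d, fun y hy => ?_⟩
        have := hmemA y hy
        rw [hc] at this
        simpa using this
      · exact absurd h hk
    obtain ⟨c, d, hcd⟩ := hcd
    refine rich_two c d v hcd (TT_of_grow v c d hg ?_ ?_ ?_)
    · intro y z z' h h' hz
      have := hcd z (h.subset (by simp)); have := hcd z' (h'.subset (by simp))
      grind
    · intro y z z' h h' hz
      have := hcd z (h.subset (by simp)); have := hcd z' (h'.subset (by simp))
      grind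
    · rintro ⟨x, x', y, y', hx, hy, q1, q2, q3, q4⟩
      have hsix : ({[x, y], [x, y'], [x', y], [x', y']} : Finset (List A)) ⊆ facLen v 2 := by
        intro e he
        simp only [Finset.mem_insert, Finset.mem_singleton] at he
        rw [mem_facLen]
        rcases he with rfl | rfl | rfl | rfl
        · exact ⟨q1, rfl⟩
        · exact ⟨q2, rfl⟩
        · exact ⟨q3, rfl⟩
        · exact ⟨q4, rfl⟩
      have h5 := Finset.card_le_card hsix
      have h6 : ({[x, y], [x, y'], [x', y], [x', y']} : Finset (List A)).card = 4 := by
        simp [Finset.card_insert_of_notMem, hx, hy]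
      have : 1 + 1 = 2 := rfl
      rw [this] at hgr
      omega

theorem det_prefix (S : A → Prop) (v : List A)
    (hD : ∀ y z z' : A, S y → S z → S z' → [y, z] <:+: v → [y, z'] <:+: v → z = z')
    (h : A) (p q : List A) (hp : h :: p <:+: v) (hq : h :: q <:+: v)
    (hpS : ∀ y ∈ h :: p, S y) (hqS : ∀ y ∈ h :: q, S y) : p <+: q ∨ q <+: p := by
  induction p generalizing h q with
  | nil => simp
  | cons y p ih =>
    rcases q with _ | ⟨z, q⟩
    · simp
    · have : y = z := hD h y z (hpS h (by simp)) (hpS y (by simp)) (hqS z (by simp))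
        (List.IsInfix.trans ⟨[], p, by simp⟩ hp) (List.IsInfix.trans ⟨[], q, by simp⟩ hq)
      subst this
      have := ih y q (List.IsInfix.trans ⟨[h], [], by simp⟩ hp)
        (List.IsInfix.trans ⟨[h], [], by simp⟩ hq)
        (fun w hw => hpS w (List.mem_cons_of_mem _ hw)) (fun w hw => hqS w (List.mem_cons_of_mem _ hw))
      simpa using this

theorem core_not_rich (v p q : List A) (x : A) (hg : Grow v) (hv : v = p ++ [x] ++ q)
    (hp : p ≠ []) (hq : q ≠ []) (hppal : p.reverse = p) (hqpal : q.reverse = q)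
    (hpmax : ∀ p' : List A, p' <+: v → p'.reverse = p' → p'.length ≤ p.length)
    (hqmax : ∀ q' : List A, q' <:+ v → q'.reverse = q' → q'.length ≤ q.length)
    (hsub : ∀ y ∈ q, y ∈ p) (hx : x ∉ p) : ¬ Rich v := by
  classical
  obtain ⟨b, p1, hp1⟩ := List.exists_cons_of_ne_nil hp
  obtain ⟨z, q1, hq1⟩ := List.exists_cons_of_ne_nil hq
  have hp2 : p = p1.reverse ++ [b] := by rw [← hppal, hp1]; simp
  have hbp : b ∈ p := by rw [hp1]; simp
  have hzp : z ∈ p := hsub z (by rw [hq1]; simp)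
  have hpv : p <:+: v := ⟨[], [x] ++ q, by rw [hv]; simp⟩
  have hqv : q <:+: v := ⟨p ++ [x], [], by rw [hv]; simp⟩
  by_cases hbz : b = z
  · exfalso
    subst hbz
    obtain ⟨E, hE, hc⟩ := edge_pal p hp hppal
    have hA : Alph v = insert x (Alph p) := by
      ext y
      rw [hv]
      simp only [Alph, List.mem_toFinset, List.mem_append, List.mem_singleton, Finset.mem_insert]
      have := hsub y
      tauto
    have hAc : (Alph v).card = (Alph p).card + 1 := by
      rw [hA, Finset.card_insert_of_notMem]
      simpa [Alph] using hx
    have hElet : ∀ e ∈ E, x ∉ e := by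
      intro e he hxe
      obtain ⟨y, y', h1, h2, h3, h4⟩ := hE e he
      rw [h1] at hxe
      exact hx (h3.subset hxe)
    have hxb : x ≠ b := by rintro rfl; exact hx hbp
    have hsubF : insert [b, x] (insert [x, b] E) ⊆ facLen v 2 := by
      intro e he
      rw [mem_facLen]
      simp only [Finset.mem_insert] at he
      rcases he with rfl | rfl | he
      · exact ⟨⟨p1.reverse, q, by rw [hv, hp2]; simp⟩, rfl⟩
      · exact ⟨⟨p, q1, by rw [hv, hq1]; simp⟩, rfl⟩
      · obtain ⟨y, y', h1, h2, h3, h4⟩ := hE e he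
        rw [h1]
        exact ⟨h3.trans hpv, rfl⟩
    have hcard : (insert [b, x] (insert [x, b] E)).card = E.card + 2 := by
      rw [Finset.card_insert_of_notMem, Finset.card_insert_of_notMem]
      · intro h; exact hElet _ h (by simp)
      · rw [Finset.mem_insert, not_or]
        exact ⟨by simp [hxb], fun h => hElet _ h (by simp)⟩
    have hle := Finset.card_le_card hsubF
    have hgr := hg 1 le_rfl
    rw [C_one, C_eq, hAc] at hgr
    have h11 : 1 + 1 = 2 := rfl
    rw [h11] at hgr
    have hpos : 0 < (Alph p).card := Finset.card_pos.2 ⟨b, by simpa [Alph] using hbp⟩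
    have hD : ∀ y z z' : A, y ∈ p → z ∈ p → z' ∈ p → [y, z] <:+: v → [y, z'] <:+: v → z = z' := by
      intro y z z' hy hz hz' h1 h2
      have hk : (Alph p).card = 1 ∨ (Alph p).card = 2 := by omega
      have my : y ∈ Alph p := by simpa [Alph] using hy
      have mz : z ∈ Alph p := by simpa [Alph] using hz
      have mz' : z' ∈ Alph p := by simpa [Alph] using hz'
      rcases hk with hk | hk
      · exact Finset.card_le_one.1 hk.le _ mz _ mz'
      · have heq := Finset.eq_of_subset_of_card_le hsubF (by omega)
        have hoff : ∀ z : A, z ∈ p → [y, z] <:+: v → y ≠ z := by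
          intro z hz h
          have hm : [y, z] ∈ insert [b, x] (insert [x, b] E) := by
            rw [heq, mem_facLen]; exact ⟨h, rfl⟩
          simp only [Finset.mem_insert, List.cons.injEq, and_true] at hm
          rcases hm with ⟨-, rfl⟩ | ⟨rfl, -⟩ | hm
          · exact absurd hz hx
          · exact absurd hy hx
          · obtain ⟨y', z', e1, e2, -, -⟩ := hE _ hm
            simp only [List.cons.injEq, and_true] at e1
            rw [e1.1, e1.2]; exact e2
        obtain ⟨c, d, hcd, hcd2⟩ := Finset.card_eq_two.1 hk
        rw [hcd2] at my mz mz'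
        have := hoff z hz h1
        have := hoff z' hz' h2
        simp only [Finset.mem_insert, Finset.mem_singleton] at my mz mz'
        grind
    have hpre := det_prefix (fun y => y ∈ p) v hD b p1 q1 (hp1 ▸ hpv) (hq1 ▸ hqv)
      (fun y hy => by rw [hp1]; exact hy) (fun y hy => hsub y (by rw [hq1]; exact hy))
    rcases hpre with h | h
    · have h' : p <+: q := by rw [hp1, hq1]; simpa using h
      obtain ⟨r, hr⟩ := h'
      have := hpmax (p ++ [x] ++ p) ⟨r, by rw [hv, ← hr]; simp⟩ (by simp [hppal])
      simp at this
    · have h' : q <+: p := by rw [hp1, hq1]; simpa using h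
      have h2 : q <:+ p := by rw [← List.reverse_prefix, hppal, hqpal]; exact h'
      obtain ⟨r, hr⟩ := h2
      have := hqmax (q ++ [x] ++ q) ⟨r, by rw [hv, ← hr]; simp⟩ (by simp [hqpal])
      simp at this
  · have hxz : x ≠ z := by rintro rfl; exact hx hzp
    have hpal := palset_concat (p ++ [x]) [z] z ⟨p ++ [x], rfl⟩ rfl (by
      intro t ht htp
      by_contra hlt
      simp only [List.length_singleton, not_le] at hlt
      obtain ⟨l, hl⟩ := ht
      obtain ⟨t1, t2, ht12, ht2⟩ := last_of_append t 2 (by omega)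
      have e : (l ++ t1) ++ t2 = p ++ [x, z] := by
        rw [List.append_assoc, ← ht12, hl]; simp
      obtain ⟨e1, e2⟩ := List.append_inj' e (by simp [ht2])
      subst e2
      rw [ht12] at htp
      rcases t1 with _ | ⟨f, _ | ⟨f', t1⟩⟩
      · simp at htp; exact hxz htp.1.symm
      · simp at htp
        rw [hp2] at e1
        have := (List.append_inj' e1 rfl).2
        simp at this
        apply hbz
        rw [← this, htp.2]
      · simp at htp
        apply hx
        rw [← e1, htp.2.1]; simp)
    rw [Finset.insert_eq_of_mem] at hpal
    · intro hr
      rw [rich_iff] at hr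
      have e : v = (p ++ [x] ++ [z]) ++ q1 := by rw [hv, hq1]; simp
      have h1 := card_palset_append_le (p ++ [x] ++ [z]) q1
      rw [hpal, ← e, hr] at h1
      have h2 := card_palset_le (p ++ [x])
      rw [e] at h1
      simp only [List.length_append, List.length_singleton] at h1 h2
      omega
    · rw [mem_palset]
      refine ⟨?_, rfl⟩
      obtain ⟨s, t, hst⟩ := List.append_of_mem hzp
      exact ⟨s, t ++ [x], by rw [hst]; simp⟩

theorem core (v p q : List A) (x : A) (hg : Grow v) (hv : v = p ++ [x] ++ q)
    (hppal : p.reverse = p) (hqpal : q.reverse = q)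
    (hpmax : ∀ p' : List A, p' <+: v → p'.reverse = p' → p'.length ≤ p.length)
    (hqmax : ∀ q' : List A, q' <:+ v → q'.reverse = q' → q'.length ≤ q.length)
    (hsub : ∀ y ∈ q, y ∈ p) : Rich v ↔ x ∈ p := by
  have hp : p ≠ [] := by
    rintro rfl
    have := hpmax [x] ⟨q, by rw [hv]; simp⟩ rfl
    simp at this
  have hq : q ≠ [] := by
    rintro rfl
    have := hqmax [x] ⟨p, by rw [hv]; simp⟩ rfl
    simp at this
  constructor
  · intro h
    by_contra hx
    exact core_not_rich v p q x hg hv hp hq hppal hqpal hpmax hqmax hsub hx h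
  · intro hx
    apply core_rich v p hg ⟨[], [x] ++ q, by rw [hv]; simp⟩ hp hppal
    intro y hy
    rw [hv] at hy
    simp only [List.mem_append, List.mem_singleton] at hy
    rcases hy with (h | rfl) | h
    · exact h
    · exact hx
    · exact hsub y h

theorem stmt18 (w : List A) (hw : IsGT w) (v p q : List A) (x : A) (hv : v = heart w)
    (hp : p <+: v) (hppal : p.reverse = p)
    (hpmax : ∀ p' : List A, p' <+: v → p'.reverse = p' → p'.length ≤ p.length)
    (hq : q <:+ v) (hqpal : q.reverse = q)
    (hqmax : ∀ q' : List A, q' <:+ v → q'.reverse = q' → q'.length ≤ q.length)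
    (hvpq : v = p ++ [x] ++ q)
    (hsub : Alph p ⊆ Alph q ∨ Alph q ⊆ Alph p) :
    Rich w ↔ x ∈ Alph p ∪ Alph q := by
  have hsub' : (∀ y ∈ p, y ∈ q) ∨ (∀ y ∈ q, y ∈ p) := by
    rcases hsub with h | h
    · exact Or.inl (fun y hy => by
        have := h (show y ∈ Alph p by simpa [Alph] using hy)
        simpa [Alph] using this)
    · exact Or.inr (fun y hy => by
        have := h (show y ∈ Alph q by simpa [Alph] using hy)
        simpa [Alph] using this)
  obtain ⟨hg, hr⟩ := heart_reduce w hw.grow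
  rw [← hv] at hg hr
  rw [hr]
  have hmem : x ∈ Alph p ∪ Alph q ↔ x ∈ p ∨ x ∈ q := by simp [Alph]
  rw [hmem]
  rcases hsub' with h | h
  · rw [← rich_reverse, core v.reverse q p x hg.reverse (by rw [hvpq]; simp [hppal, hqpal])
      hqpal hppal ?_ ?_ h]
    · exact ⟨Or.inr, fun h' => h'.elim (h x) id⟩
    · intro q' h1 h2
      apply hqmax q' _ h2
      rw [← List.reverse_prefix, h2]; exact h1
    · intro p' h1 h2
      apply hpmax p' _ h2
      rw [← List.reverse_suffix, h2]; exact h1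
  · rw [core v p q x hg hvpq hppal hqpal hpmax hqmax h]
    exact ⟨Or.inl, fun h' => h'.elim id (h x)⟩
end

section
/- Let w be a generalized trapezoidal word with heart v, let p be the longest palindromic prefix of v and q the longest palindromic suffix of v, and suppose v = p·u·q where |u| ≥ 2 and Alph(p) ⊆ Alph(q) or Alph(q) ⊆ Alph(p). Then Alph(u) is not contained in Alph(p) ∪ Alph(q); moreover, w is not rich. -/
open List

variable {A : Type*} [DecidableEq A]

namespace GTW

/-- The morphism inserting `s` before every letter different from `s`. -/
def phi (s : A) (l : List A) : List A := l.flatMap (fun x => if x = s then [s] else [s, x])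


theorem phi_nil (s : A) : phi s [] = [] := rfl

theorem phi_append (s : A) (l m : List A) : phi s (l ++ m) = phi s l ++ phi s m := by
  simp [phi]

theorem phi_cons (s x : A) (l : List A) :
    phi s (x :: l) = (if x = s then [s] else [s, x]) ++ phi s l := by
  simp [phi]

theorem phi_reverse (s : A) (l : List A) :
    (phi s l ++ [s]).reverse = phi s l.reverse ++ [s] := by
  induction l with
  | nil => simp [phi_nil]
  | cons x t ih =>
    rw [phi_cons, List.reverse_cons, phi_append, List.append_assoc, List.reverse_append, ih,
      phi_cons, phi_nil]
    by_cases h : x = s <;> simp [h]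

theorem phi_start (s : A) (l : List A) : ∃ r, phi s l ++ [s] = s :: r := by
  cases l with
  | nil => exact ⟨[], rfl⟩
  | cons x t =>
    by_cases h : x = s
    · exact ⟨phi s t ++ [s], by simp [phi_cons, h]⟩
    · exact ⟨x :: (phi s t ++ [s]), by simp [phi_cons, h]⟩

theorem mem_phi (s x : A) (l : List A) (h : x ∈ l) : x ∈ phi s l := by
  simp only [phi, List.mem_flatMap]
  refine ⟨x, h, ?_⟩
  by_cases hx : x = s <;> simp [hx]

theorem length_phi (s : A) (l : List A) :
    (phi s l).length = l.length + (phi s l).countP (fun x => !decide (x = s)) := by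
  induction l with
  | nil => simp [phi_nil]
  | cons x t ih =>
    rw [phi_cons]
    by_cases h : x = s
    · simp [h]; omega
    · simp [h]; omega

theorem phi_pos (s : A) (l : List A) (h : l ≠ []) : 1 ≤ (phi s l).length := by
  cases l with
  | nil => exact absurd rfl h
  | cons x t =>
    rw [phi_cons]
    by_cases h : x = s <;> simp [h]

theorem decode (s : A) : ∀ (n : ℕ) (V : List A), V.length ≤ n →
    (∀ x y, [x, y] <:+: s :: V → x = s ∨ y = s) → (s :: V).getLast? = some s →
    ∃ l, s :: V = phi s l ++ [s] := by
  intro n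
  induction n with
  | zero =>
    intro V hV _ _
    have : V = [] := List.length_eq_zero_iff.mp (by omega)
    exact ⟨[], by simp [this, phi_nil]⟩
  | succ n ih =>
    intro V hV hadj hlast
    match V, hV, hadj, hlast with
    | [], _, _, _ => exact ⟨[], by simp [phi_nil]⟩
    | x :: V2, hV, hadj, hlast =>
      by_cases hx : x = s
      · subst hx
        obtain ⟨l, hl⟩ := ih V2 (by simp at hV; omega)
          (fun y z h => hadj y z (List.infix_cons h))
          (by simpa [List.getLast?_cons_cons] using hlast)
        exact ⟨x :: l, by rw [phi_cons, hl]; simp⟩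
      · match V2, hV, hadj, hlast with
        | [], _, _, hlast => simp at hlast; exact absurd hlast hx
        | y :: V3, hV, hadj, hlast =>
          have hy : y = s := by
            rcases hadj x y ⟨[s], V3, by simp⟩ with h | h
            · exact absurd h hx
            · exact h
          subst hy
          obtain ⟨l, hl⟩ := ih V3 (by simp at hV; omega)
            (fun a b h => hadj a b (List.infix_cons (List.infix_cons h)))
            (by simpa [List.getLast?_cons_cons] using hlast)
          exact ⟨x :: l, by rw [phi_cons, hl]; simp [hx]⟩

theorem transfer (s x y : A) (g l : List A) (h : x :: g ++ [y] <:+: l) :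
    x :: (phi s g ++ [s]) ++ [y] <:+: phi s l ++ [s] := by
  obtain ⟨α, β, rfl⟩ := h
  have h1 : ∃ d, phi s [x] = d ++ [x] := by
    by_cases hx : x = s
    · exact ⟨[], by simp [phi_cons, phi_nil, hx]⟩
    · exact ⟨[s], by simp [phi_cons, phi_nil, hx]⟩
  have h2 : ∃ r, phi s [y] ++ (phi s β ++ [s]) = s :: y :: r := by
    by_cases hy : y = s
    · obtain ⟨r, hr⟩ := phi_start s β
      exact ⟨r, by rw [hr]; simp [phi_cons, phi_nil, hy]⟩
    · exact ⟨phi s β ++ [s], by simp [phi_cons, phi_nil, hy]⟩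
  obtain ⟨d, hd⟩ := h1
  obtain ⟨r, hr⟩ := h2
  refine ⟨phi s α ++ d, r, ?_⟩
  have : α ++ (x :: g ++ [y]) ++ β = α ++ [x] ++ g ++ [y] ++ β := by simp
  rw [this]
  simp only [phi_append, List.append_assoc]
  rw [hr, hd]
  simp

theorem unpad (s b x : A) (r t : List A) (hb : b ≠ s) (h : x :: s :: r <:+: s :: b :: t) :
    x :: s :: r <:+: b :: t := by
  rcases List.infix_cons_iff.mp h with h | h
  · obtain ⟨e, he⟩ := h
    simp at he
    exact absurd he.2.1.symm hb
  · exact h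

theorem ss_of_mem (s : A) (l : List A) (h : s ∈ l) : [s, s] <:+: phi s l ++ [s] := by
  obtain ⟨l1, l2, rfl⟩ := List.append_of_mem h
  obtain ⟨r, hr⟩ := phi_start s l2
  refine ⟨phi s l1, r, ?_⟩
  rw [phi_append, phi_cons]
  simp [hr]

theorem phi_prefix (s : A) (p l : List A) (h : p <+: l) :
    phi s p ++ [s] <+: phi s l ++ [s] := by
  obtain ⟨t, rfl⟩ := h
  obtain ⟨r, hr⟩ := phi_start s t
  exact ⟨r, by rw [phi_append, List.append_assoc, List.append_assoc, hr]; simp⟩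

theorem phi_pal (s : A) (p : List A) (h : p.reverse = p) :
    (phi s p ++ [s]).reverse = phi s p ++ [s] := by
  rw [phi_reverse, h]

/-- stripping the padded letters from a palindromic prefix -/
theorem strip (s b : A) (t e l p : List A) (hb : b ≠ s) (he : e.length ≤ 1)
    (hV : s :: (b :: t ++ e) = phi s l ++ [s]) (hp : p <+: l) (hp0 : p ≠ [])
    (hpal : p.reverse = p) :
    ∃ P, P ≠ [] ∧ P.reverse = P ∧ P <+: b :: t ∧ P.length + 1 = (phi s p).length := by
  have h1 := phi_prefix s p l hp
  have h2 := phi_pal s p hpal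
  rw [← hV] at h1
  cases p with
  | nil => exact absurd rfl hp0
  | cons x r =>
    by_cases hx : x = s
    · subst hx
      rw [phi_cons] at h1
      obtain ⟨k, hk⟩ := phi_start x r
      simp [hk] at h1
      exact absurd h1.1.symm hb
    · have e1 : phi s (x :: r) ++ [s] = s :: (x :: phi s r ++ [s]) := by
        rw [phi_cons]; simp [hx]
      rw [e1] at h1 h2
      refine ⟨x :: phi s r, by simp, ?_, ?_, ?_⟩
      · have h5 : (x :: phi s r).reverse ++ [s] = (x :: phi s r) ++ [s] := by
          simpa using h2
        exact List.append_cancel_right h5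
      · have h3 : x :: phi s r ++ [s] <+: (b :: t) ++ e := by
          simpa using h1
        have h4 := h3.length_le
        refine List.prefix_of_prefix_length_le ((List.prefix_append _ _).trans h3)
          (List.prefix_append _ _) ?_
        simp at h4 ⊢
        omega
      · rw [phi_cons]; simp [hx]

/-- length estimate for covers -/
theorem cover (s : A) (l p q : List A) (hp : p <+: l) (hq : q <+: l.reverse)
    (hqpal : q.reverse = q) (h : l.length ≤ p.length + q.length) :
    (phi s l).length ≤ (phi s p).length + (phi s q).length ∧
    (l.length + 1 ≤ p.length + q.length → p.getLast? ≠ some s →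
      (phi s l).length + 2 ≤ (phi s p).length + (phi s q).length) := by
  obtain ⟨t, rfl⟩ := hp
  have hq' : q <:+ p ++ t := by
    rw [← List.reverse_prefix, hqpal]; exact hq
  have ht : t <:+ q := by
    refine List.suffix_of_suffix_length_le (List.suffix_append p t) hq' ?_
    simp at h; omega
  obtain ⟨o, rfl⟩ := ht
  obtain ⟨r, hr⟩ := hq'
  rw [← List.append_assoc] at hr
  have hr' : r ++ o = p := List.append_cancel_right hr
  refine ⟨by simp [phi_append], ?_⟩
  intro h1 h2
  have ho : o ≠ [] := by
    rintro rfl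
    simp at h1
  obtain ⟨o', z, rfl⟩ : ∃ o' z, o = o' ++ [z] := 
    ⟨o.dropLast, o.getLast ho, (List.dropLast_append_getLast ho).symm⟩
  have hz : z ≠ s := by
    rintro rfl
    apply h2
    rw [← hr']
    simp
  simp only [phi_append, List.length_append, phi_cons, phi_nil]
  simp [hz]
  omega

end GTW

namespace GTW

/-- `p` is a nonempty palindromic prefix and `q` a nonempty palindromic suffix (read backwards). -/
def PalPair (v p q : List A) : Prop :=
  p ≠ [] ∧ q ≠ [] ∧ p.reverse = p ∧ q.reverse = q ∧ p <+: v ∧ q <+: v.reverse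

theorem PalPair.rev {v p q : List A} (h : PalPair v p q) : PalPair v.reverse q p := by
  obtain ⟨a, b, c, d, e, f⟩ := h
  exact ⟨b, a, d, c, f, by simpa using e⟩

/-- `l` is a desubstitution of `v` with respect to the letter `s`. -/
structure Des (s : A) (v l : List A) : Prop where
  ne : l ≠ []
  len : l.length < v.length
  mem : ∀ x ∈ l, x ∈ v ∨ x = s
  ss : s ∈ l → [s, s] <:+: v
  tr : ∀ x g y, x :: g ++ [y] <:+: l → x :: (phi s g ++ [s]) ++ [y] <:+: v
  pal : ∀ p q, PalPair l p q → l.length ≤ p.length + q.length →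
    ∃ P Q, PalPair v P Q ∧ v.length ≤ P.length + Q.length + 1 ∧
      (v.head? = some s ∨ v.getLast? = some s → v.length ≤ P.length + Q.length) ∧
      ((l.head? = l.getLast? → l.length + 1 ≤ p.length + q.length) →
        v.head? = v.getLast? → v.length + 1 ≤ P.length + Q.length)

theorem tr_rev (s x y : A) (g : List A) :
    (x :: (phi s g ++ [s]) ++ [y]).reverse = y :: (phi s g.reverse ++ [s]) ++ [x] := by
  have e : ∀ W : List A, (x :: W ++ [y]).reverse = y :: W.reverse ++ [x] := by
    intro W; simp
  rw [e, phi_reverse]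

theorem Des.rev {s : A} {v l : List A} (h : Des s v l) : Des s v.reverse l.reverse := by
  refine ⟨by simpa using h.ne, by simpa using h.len, by simpa using h.mem, ?_, ?_, ?_⟩
  · intro hs
    have := h.ss (by simpa using hs)
    rw [← List.reverse_infix] at this
    simpa using this
  · intro x g y hxy
    have h1 : y :: g.reverse ++ [x] <:+: l := by
      rw [← List.reverse_infix]
      simpa using hxy
    have h2 := h.tr _ _ _ h1
    rw [← List.reverse_infix, tr_rev] at h2
    simpa using h2
  · intro p q hpq hlen
    obtain ⟨P, Q, h1, h2, h3, h4⟩ := h.pal q p (by simpa using hpq.rev)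
      (by simp at hlen; omega)
    refine ⟨Q, P, h1.rev, by simp; omega, ?_, ?_⟩
    · intro h5
      have := h3 (by simpa using h5.symm)
      simp; omega
    · intro h5 h6
      have := h4 (fun h7 => by
        have := h5 (by simpa using h7.symm)
        simp at this; omega) (by simpa using h6.symm)
      simp; omega

theorem des_SS (s : A) (v l : List A) (h2 : 2 ≤ v.length) (hV : v = phi s l ++ [s]) :
    Des s v l := by
  have hlen : v.length = (phi s l).length + 1 := by rw [hV]; simp
  have hl := length_phi s l
  refine ⟨?_, by omega, ?_, ?_, ?_, ?_⟩
  · rintro rfl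
    simp [phi_nil] at hlen
    omega
  · intro x hx
    left
    rw [hV]
    exact List.mem_append_left _ (mem_phi s x l hx)
  · intro h; rw [hV]; exact ss_of_mem s l h
  · intro x g y h; rw [hV]; exact transfer s x y g l h
  · intro p q ⟨hp0, hq0, hp, hq, hpl, hql⟩ hle
    have hc := (cover s l p q hpl hql hq hle).1
    refine ⟨phi s p ++ [s], phi s q ++ [s], ⟨by simp, by simp, phi_pal s p hp, phi_pal s q hq,
      ?_, ?_⟩, ?_, ?_, ?_⟩
    · rw [hV]; exact phi_prefix s p l hpl
    · rw [hV, phi_reverse]; exact phi_prefix s q _ hql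
    · simp; omega
    · intro _; simp; omega
    · intro _ _; simp; omega

theorem head_phi (s b : A) (t l : List A) (hb : b ≠ s) (hV : s :: b :: t = phi s l ++ [s]) :
    l.head? = some b := by
  cases l with
  | nil => simp [phi_nil] at hV
  | cons x r =>
    by_cases hx : x = s
    · subst hx
      obtain ⟨k, hk⟩ := phi_start x r
      rw [phi_cons, List.append_assoc, hk] at hV
      simp at hV
      exact absurd hV.1 hb
    · rw [phi_cons] at hV
      simp [hx] at hV
      simp [hV.1]

theorem length_phi_reverse (s : A) (l : List A) :
    (phi s l.reverse).length = (phi s l).length := by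
  have := congrArg List.length (phi_reverse s l)
  simp at this
  exact this.symm

theorem des_BS (s b : A) (t l : List A) (h2 : 2 ≤ (b :: t).length) (hb : b ≠ s)
    (hlast : (b :: t).getLast? = some s)
    (hV : s :: b :: t = phi s l ++ [s]) : Des s (b :: t) l := by
  have hlen : (b :: t).length = (phi s l).length := by
    have := congrArg List.length hV
    simp at this ⊢; omega
  have hl := length_phi s l
  have hcount : 1 ≤ (phi s l).countP (fun x => !decide (x = s)) := by
    have := congrArg (List.countP (fun x => !decide (x = s))) hV
    simp only [List.countP_cons, List.countP_append, List.countP_nil, hb] at this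
    simp at this
    omega
  have hh := head_phi s b t l hb hV
  refine ⟨?_, by omega, ?_, ?_, ?_, ?_⟩
  · rintro rfl
    simp at hh
  · intro x hx
    have : x ∈ s :: b :: t := by
      rw [hV]
      exact List.mem_append_left _ (mem_phi s x l hx)
    rcases List.mem_cons.mp this with h | h
    · exact Or.inr h
    · exact Or.inl h
  · intro h
    have h1 := ss_of_mem s l h
    rw [← hV] at h1
    exact unpad s b s [] t hb h1
  · intro x g y h
    have h1 := transfer s x y g l h
    rw [← hV] at h1
    obtain ⟨r, hr⟩ := phi_start s g
    rw [hr] at h1 ⊢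
    exact unpad s b x (r ++ [y]) t hb h1
  · intro p q ⟨hp0, hq0, hp, hq, hpl, hql⟩ hle
    have hc := (cover s l p q hpl hql hq hle).1
    have hne : (b :: t).head? ≠ (b :: t).getLast? := by
      rw [hlast]; simpa using hb
    by_cases hqq : q.length = l.length
    · have hq1 : q = l.reverse := hql.eq_of_length (by simpa using hqq)
      have hlp : l.reverse = l := by
        rw [hq1] at hq
        simpa using hq.symm
      obtain ⟨P, hP0, hP, hPv, hPl⟩ := strip s b t [] l l hb (by simp) (by simpa using hV)
        (List.prefix_refl l) (by rintro rfl; simp at hh) hlp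
      have hpre : [s] <+: (b :: t).reverse := by
        rw [← List.head?_reverse] at hlast
        cases hr : (b :: t).reverse with
        | nil => simp at hr
        | cons c r => rw [hr] at hlast; simp at hlast; simp [hlast]
      refine ⟨P, [s], ⟨hP0, by simp, hP, by simp, hPv, hpre⟩, ?_, ?_, ?_⟩
      · rw [hlen]; simp; omega
      · intro _; rw [hlen]; simp; omega
      · intro _ h; exact absurd h hne
    · obtain ⟨P, hP0, hP, hPv, hPl⟩ := strip s b t [] l p hb (by simp) (by simpa using hV)
        hpl hp0 hp
      have hlt : (phi s q).length < (phi s l).length := by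
        obtain ⟨r, hr⟩ := hql
        have hr0 : r ≠ [] := by
          rintro rfl
          apply hqq
          have := congrArg List.length hr
          simpa using this
        have h1 := phi_pos s r hr0
        rw [← length_phi_reverse s l, ← hr, phi_append]
        simp; omega
      have hpre : phi s q ++ [s] <+: (b :: t).reverse := by
        have h1 := phi_prefix s q _ hql
        rw [← phi_reverse, ← hV, List.reverse_cons] at h1
        refine List.prefix_of_prefix_length_le h1 (List.prefix_append _ _) ?_
        rw [List.length_reverse, hlen]; simp; omega
      refine ⟨P, phi s q ++ [s], ⟨hP0, by simp, hP, phi_pal s q hq, hPv, hpre⟩, ?_, ?_, ?_⟩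
      · rw [hlen]; simp; omega
      · intro _; rw [hlen]; simp; omega
      · intro _ h; exact absurd h hne

theorem des_BB (s b c : A) (t t' l : List A) (h2 : 2 ≤ (b :: t).length) (hb : b ≠ s) (hc : c ≠ s)
    (hr : (b :: t).reverse = c :: t')
    (hV : s :: (b :: t ++ [s]) = phi s l ++ [s]) : Des s (b :: t) l := by
  have hlen : (b :: t).length + 1 = (phi s l).length := by
    have := congrArg List.length hV
    simp at this ⊢; omega
  have hl := length_phi s l
  have hVr : s :: (c :: t' ++ [s]) = phi s l.reverse ++ [s] := by
    rw [← phi_reverse, ← hV, ← hr]; simp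
  have hlast : (b :: t).getLast? = some c := by
    rw [← List.head?_reverse, hr]; simp
  have hct : c ∈ t := by
    cases t with
    | nil => simp at h2
    | cons d t => 
      rw [List.getLast?_cons_cons] at hlast
      exact List.mem_of_getLast? hlast
  have hcount : 2 ≤ (phi s l).countP (fun x => !decide (x = s)) := by
    have h1 := congrArg (List.countP (fun x => !decide (x = s))) hV
    have h3 : 0 < t.countP (fun x => !decide (x = s)) := by
      rw [List.countP_pos_iff]
      exact ⟨c, hct, by simpa using hc⟩
    simp only [List.countP_cons, List.countP_append, List.countP_nil, hb] at h1
    simp at h1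
    omega
  have hh := head_phi s b (t ++ [s]) l hb hV
  have hh' := head_phi s c (t' ++ [s]) l.reverse hc hVr
  rw [List.head?_reverse] at hh'
  refine ⟨?_, by omega, ?_, ?_, ?_, ?_⟩
  · rintro rfl
    simp at hh
  · intro x hx
    have : x ∈ s :: (b :: t ++ [s]) := by
      rw [hV]
      exact List.mem_append_left _ (mem_phi s x l hx)
    simp at this ⊢
    tauto
  · intro h
    have h1 := ss_of_mem s l h
    rw [← hV] at h1
    have h3 := unpad s b s [] (t ++ [s]) hb h1
    rw [← List.reverse_infix] at h3
    have h4 : (b :: (t ++ [s])).reverse = s :: c :: t' := by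
      rw [← hr]; simp
    rw [h4] at h3
    have h5 := unpad s c s [] t' hc h3
    rw [← hr, ← List.reverse_infix] at h5
    simpa using h5
  · intro x g y h
    have h1 := transfer s x y g l h
    rw [← hV] at h1
    obtain ⟨r, hr1⟩ := phi_start s g
    obtain ⟨r', hr2⟩ := phi_start s g.reverse
    have h3 : x :: (phi s g ++ [s]) ++ [y] <:+: b :: (t ++ [s]) := by
      rw [hr1] at h1 ⊢
      exact unpad s b x (r ++ [y]) (t ++ [s]) hb h1
    have h4 : (b :: (t ++ [s])).reverse = s :: c :: t' := by
      rw [← hr]; simp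
    rw [← List.reverse_infix, h4, tr_rev, hr2] at h3
    have h5 := unpad s c y (r' ++ [x]) t' hc h3
    rw [← hr, ← List.reverse_infix, List.reverse_reverse] at h5
    have h6 := tr_rev s y x g.reverse
    rw [hr2, List.reverse_reverse] at h6
    rw [← h6]
    exact h5
  · intro p q ⟨hp0, hq0, hp, hq, hpl, hql⟩ hle
    have hcov := cover s l p q hpl hql hq hle
    obtain ⟨P, hP0, hP, hPv, hPl⟩ := strip s b t [s] l p hb (by simp) hV hpl hp0 hp
    obtain ⟨Q, hQ0, hQ, hQv, hQl⟩ := strip s c t' [s] l.reverse q hc (by simp) hVr hql hq0 hq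
    refine ⟨P, Q, ⟨hP0, hQ0, hP, hQ, hPv, by rw [hr]; exact hQv⟩, by omega, ?_, ?_⟩
    · rw [hlast]
      simp [hb, hc]
    · intro h3 h4
      rw [hlast] at h4
      have hbc : b = c := by simpa using h4
      have h5 := h3 (by rw [hh, hh', hbc])
      have h6 := hcov.2 h5 (by
        rw [← List.head?_reverse, hp]
        obtain ⟨r, rfl⟩ := hpl
        cases p with
        | nil => exact absurd rfl hp0
        | cons x p => simp at hh; simp [hh, hb])
      omega

theorem desub (s : A) (v : List A) (hv : ∀ x y, [x, y] <:+: v → x = s ∨ y = s)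
    (h2 : 2 ≤ v.length) : ∃ l, Des s v l := by
  -- front padding
  have front : ∀ (b : A) (t : List A), b ≠ s → (∀ x y, [x, y] <:+: b :: t → x = s ∨ y = s) →
      2 ≤ (b :: t).length → (b :: t).getLast? = some s → ∃ l, Des s (b :: t) l := by
    intro b t hb hv h2 hlast
    obtain ⟨l, hl⟩ := decode s _ (b :: t) le_rfl (by
      intro x y hxy
      rcases List.infix_cons_iff.mp hxy with h | h
      · simp at h; exact Or.inl h.1
      · exact hv x y h) (by rw [List.getLast?_cons_cons]; exact hlast)
    exact ⟨l, des_BS s b t l h2 hb hlast hl⟩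
  match v, hv, h2 with
  | b :: t, hv, h2 =>
    obtain ⟨c, t', hr⟩ : ∃ c t', (b :: t).reverse = c :: t' := by
      cases h : (b :: t).reverse with
      | nil => simp at h
      | cons c t' => exact ⟨c, t', rfl⟩
    have hlast : (b :: t).getLast? = some c := by
      rw [← List.head?_reverse, hr]; simp
    have hvr : ∀ x y, [x, y] <:+: c :: t' → x = s ∨ y = s := by
      intro x y hxy
      rw [← hr, ← List.reverse_infix] at hxy
      exact (hv y x (by simpa using hxy)).symm
    by_cases hb : b = s
    · by_cases hc : c = s
      · subst hb
        obtain ⟨l, hl⟩ := decode b _ t le_rfl hv (by rw [hlast, hc])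
        exact ⟨l, des_SS b _ l h2 hl⟩
      · obtain ⟨l, hl⟩ := front c t' hc hvr (by rw [← hr]; simpa using h2) (by
          rw [← hr]; simp [hb])
        refine ⟨l.reverse, ?_⟩
        have := hl.rev
        rw [← hr, List.reverse_reverse] at this
        exact this
    · by_cases hc : c = s
      · exact front b t hb hv h2 (by rw [hlast, hc])
      · obtain ⟨l, hl⟩ := decode s _ (b :: t ++ [s]) le_rfl (by
          intro x y hxy
          rcases List.infix_cons_iff.mp hxy with h | h
          · simp at h; exact Or.inl h.1
          · rw [← List.reverse_infix] at h
            simp only [List.reverse_append, hr] at h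
            rcases List.infix_cons_iff.mp h with h | h
            · simp at h; exact Or.inr h.1
            · exact (hvr y x (by simpa using h)).symm) (by
            rw [← List.head?_reverse]; simp)
        exact ⟨l, des_BB s b c t t' l h2 hb hc hr hl⟩

end GTW

namespace GTW

/-- `g` is a strong bispecial factor of `v` with respect to the letters `a, b`. -/
def Strong (v : List A) (a b : A) (g : List A) : Prop :=
  a :: g ++ [a] <:+: v ∧ a :: g ++ [b] <:+: v ∧ b :: g ++ [a] <:+: v ∧ b :: g ++ [b] <:+: v

def Res (v : List A) : Prop :=
  ∃ p q, PalPair v p q ∧ v.length ≤ p.length + q.length ∧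
    (v.head? = v.getLast? → v.length + 1 ≤ p.length + q.length)

theorem res_pal (v : List A) (h0 : v ≠ []) (h : v.reverse = v) : Res v := by
  have : 0 < v.length := List.length_pos_iff.mpr h0
  exact ⟨v, v, ⟨h0, h0, h, h, List.prefix_refl v, by rw [h]⟩, by omega, fun _ => by omega⟩

theorem bin_step (s b : A) (v : List A) (hsb : b ≠ s) (hlet : ∀ x ∈ v, x = s ∨ x = b)
    (hbb : ¬ [b, b] <:+: v) (hNB : ∀ g, ¬ Strong v s b g) (h2 : 2 ≤ v.length)
    (ih : ∀ l : List A, l.length < v.length → l ≠ [] → (∀ x ∈ l, x = s ∨ x = b) →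
      (∀ g, ¬ Strong l s b g) → Res l) : Res v := by
  obtain ⟨l, hl⟩ := desub s v (by
    intro x y hxy
    by_contra hcon
    push Not at hcon
    have hx := (hlet x (hxy.subset (by simp))).resolve_left hcon.1
    have hy := (hlet y (hxy.subset (by simp))).resolve_left hcon.2
    subst hx; subst hy
    exact hbb hxy) h2
  obtain ⟨p, q, hpq, h3, h4⟩ := ih l hl.len hl.ne (by
      intro x hx
      rcases hl.mem x hx with h | h
      · exact hlet x h
      · exact Or.inl h) (by
      rintro g ⟨e1, e2, e3, e4⟩
      exact hNB (phi s g ++ [s]) ⟨hl.tr _ _ _ e1, hl.tr _ _ _ e2, hl.tr _ _ _ e3, hl.tr _ _ _ e4⟩)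
  obtain ⟨P, Q, hPQ, _, h6, h7⟩ := hl.pal p q hpq h3
  have h8 := h7 h4
  refine ⟨P, Q, hPQ, ?_, h8⟩
  by_cases hc : v.head? = some s ∨ v.getLast? = some s
  · exact h6 hc
  · push Not at hc
    have hv0 : v ≠ [] := by rintro rfl; simp at h2
    have e1 : v.head? = some (v.head hv0) := List.head?_eq_some_head hv0
    have e2 : v.getLast? = some (v.getLast hv0) := List.getLast?_eq_some_getLast hv0
    have e3 : v.head hv0 = b := (hlet _ (List.head_mem hv0)).resolve_left
      (fun h => hc.1 (by rw [e1, h]))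
    have e4 : v.getLast hv0 = b := (hlet _ (List.getLast_mem hv0)).resolve_left
      (fun h => hc.2 (by rw [e2, h]))
    have := h8 (by rw [e1, e2, e3, e4])
    omega

theorem sorted_form (a b : A) (v : List A) (hlet : ∀ x ∈ v, x = a ∨ x = b)
    (hab : ¬ [a, b] <:+: v) : ∃ i j, v = List.replicate i b ++ List.replicate j a := by
  induction v with
  | nil => exact ⟨0, 0, rfl⟩
  | cons x t ih =>
    obtain ⟨i, j, hij⟩ := ih (fun y hy => hlet y (List.mem_cons_of_mem _ hy))
      (fun h => hab (List.infix_cons h))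
    rcases hlet x (by simp) with h | h
    · subst h
      cases i with
      | zero => exact ⟨0, j + 1, by rw [hij]; simp [List.replicate_succ]⟩
      | succ i =>
        exfalso
        apply hab
        rw [hij]
        exact ⟨[], List.replicate i b ++ List.replicate j x, by simp [List.replicate_succ]⟩
    · subst h
      exact ⟨i + 1, j, by rw [hij]; simp [List.replicate_succ]⟩

theorem res_sorted (a b : A) (hab : a ≠ b) (i j : ℕ) (v : List A) (h0 : v ≠ [])
    (hv : v = List.replicate i b ++ List.replicate j a) : Res v := by
  cases i with
  | zero => exact res_pal v h0 (by rw [hv]; simp)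
  | succ i =>
    cases j with
    | zero => exact res_pal v h0 (by rw [hv]; simp)
    | succ j =>
      refine ⟨List.replicate (i + 1) b, List.replicate (j + 1) a, ⟨by simp, by simp, by simp,
        by simp, ?_, ?_⟩, ?_, ?_⟩
      · rw [hv]; exact List.prefix_append _ _
      · rw [hv, List.reverse_append, List.reverse_replicate]; exact List.prefix_append _ _
      · rw [hv]; simp
      · intro h
        exfalso
        rw [hv, List.replicate_succ, List.replicate_succ'] at h
        rw [← List.append_assoc, List.getLast?_append] at h
        simp at h
        exact hab h.symm

theorem bin (n : ℕ) : ∀ (a b : A) (v : List A), a ≠ b → v.length ≤ n → v ≠ [] →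
    (∀ x ∈ v, x = a ∨ x = b) → (∀ g, ¬ Strong v a b g) → Res v := by
  induction n with
  | zero =>
    intro a b v _ hn h0
    exact absurd (List.length_eq_zero_iff.mp (by omega)) h0
  | succ n ih =>
    intro a b v hab hn h0 hlet hNB
    by_cases h2 : 2 ≤ v.length
    · by_cases hbb : [b, b] <:+: v
      · by_cases haa : [a, a] <:+: v
        · by_cases h3 : [a, b] <:+: v
          · by_cases h4 : [b, a] <:+: v
            · exact absurd ⟨haa, h3, h4, hbb⟩ (hNB [])
            · obtain ⟨i, j, hij⟩ := sorted_form b a v (fun x hx => (hlet x hx).symm) h4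
              exact res_sorted b a hab.symm i j v h0 hij
          · obtain ⟨i, j, hij⟩ := sorted_form a b v hlet h3
            exact res_sorted a b hab i j v h0 hij
        · refine bin_step b a v hab (fun x hx => (hlet x hx).symm) haa ?_ h2 ?_
          · rintro g ⟨e1, e2, e3, e4⟩
            exact hNB g ⟨e4, e3, e2, e1⟩
          · intro l hl hl0 hlet' hNB'
            exact ih b a l hab.symm (by omega) hl0 hlet' hNB'
      · refine bin_step a b v hab.symm hlet hbb hNB h2 ?_
        intro l hl hl0 hlet' hNB'
        exact ih a b l hab (by omega) hl0 hlet' hNB'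
    · refine res_pal v h0 ?_
      match v, h0, h2 with
      | [x], _, _ => rfl
      | _ :: _ :: _, _, h2 => simp at h2

theorem star (s c d : A) (v : List A) (hcd : c ≠ d)
    (hlet : ∀ x ∈ v, x = s ∨ x = c ∨ x = d)
    (hadj : ∀ x y, [x, y] <:+: v → x = s ∨ y = s) (hss : ¬ [s, s] <:+: v)
    (h2 : 2 ≤ v.length) (hNB : ∀ g, g ≠ [] → ¬ Strong v c d g) :
    ∃ p q, PalPair v p q ∧ v.length ≤ p.length + q.length + 1 := by
  obtain ⟨l, hl⟩ := desub s v hadj h2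
  have hsl : s ∉ l := fun h => hss (hl.ss h)
  obtain ⟨p, q, hpq, h3, _⟩ := bin l.length c d l hcd le_rfl hl.ne (by
    intro x hx
    have hxs : x ≠ s := by rintro rfl; exact hsl hx
    have := (hlet x ((hl.mem x hx).resolve_right hxs))
    tauto) (by
    rintro g ⟨e1, e2, e3, e4⟩
    exact hNB (phi s g ++ [s]) (by simp)
      ⟨hl.tr _ _ _ e1, hl.tr _ _ _ e2, hl.tr _ _ _ e3, hl.tr _ _ _ e4⟩)
  obtain ⟨P, Q, hPQ, h5, _⟩ := hl.pal p q hpq h3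
  exact ⟨P, Q, hPQ, h5⟩

end GTW

namespace GTW

theorem mem_factors (w u : List A) : u ∈ factors w ↔ u <:+: w := by
  simp only [factors, Finset.mem_image, Finset.mem_product, Finset.mem_range, Prod.exists]
  constructor
  · rintro ⟨i, j, _, rfl⟩
    exact (List.take_prefix _ _).isInfix.trans (List.drop_suffix _ _).isInfix
  · rintro ⟨α, β, rfl⟩
    refine ⟨α.length, u.length, ⟨by simp only [List.length_append]; omega, by simp only [List.length_append]; omega⟩, ?_⟩
    simp

/-- the set of factors of length `n` -/
def Fac (w : List A) (n : ℕ) : Finset (List A) := (factors w).filter (fun u => u.length = n)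

theorem mem_Fac (w u : List A) (n : ℕ) : u ∈ Fac w n ↔ u <:+: w ∧ u.length = n := by
  simp [Fac, mem_factors]

theorem C_eq (w : List A) (n : ℕ) : C w n = (Fac w n).card := rfl

theorem C_reverse (w : List A) (n : ℕ) : C w.reverse n = C w n := by
  rw [C_eq, C_eq]
  refine Finset.card_bij (fun u _ => u.reverse) ?_ ?_ ?_
  · intro u hu
    rw [mem_Fac] at hu ⊢
    rw [← List.reverse_infix]
    simpa using hu
  · intro u _ u' _ h
    simpa using h
  · intro u hu
    refine ⟨u.reverse, ?_, by simp⟩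
    rw [mem_Fac] at hu ⊢
    rw [List.reverse_infix]
    simpa using hu

/-- The complexity grows by at most one at each step. -/
def Slow (w : List A) : Prop := ∀ n, 1 ≤ n → C w (n + 1) ≤ C w n + 1

theorem Slow.rev {w : List A} (h : Slow w) : Slow w.reverse := by
  intro n hn
  rw [C_reverse, C_reverse]
  exact h n hn

/-- The suffix of length `n` occurs elsewhere. -/
def Rep (v : List A) (n : ℕ) : Prop := ∃ S z, S <:+ v ∧ S.length = n ∧ S ++ [z] <:+: v

theorem count (v : List A) (n : ℕ) (hD : Slow v) (hn : 1 ≤ n) (hR : Rep v n)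
    (x1 x2 y1 y2 : List A) (hx1 : x1 ∈ Fac v (n + 1)) (hx2 : x2 ∈ Fac v (n + 1))
    (hy1 : y1 ∈ Fac v (n + 1)) (hy2 : y2 ∈ Fac v (n + 1))
    (h12 : x1 ≠ y1) (hx : x1.take n = x2.take n) (hy : y1.take n = y2.take n)
    (a1 : x2 ≠ x1) (a2 : x2 ≠ y1) (a3 : y2 ≠ x1) (a4 : y2 ≠ y1) : False := by
  obtain ⟨S, z, hS, hSn, hSz⟩ := hR
  have hsub : Fac v n ⊆ (((Fac v (n + 1)).erase x1).erase y1).image (fun x => x.take n) := by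
    intro f hf
    rw [mem_Fac] at hf
    obtain ⟨⟨α, β, hv⟩, hfn⟩ := hf
    have : ∃ e, f ++ [e] <:+: v := by
      cases β with
      | nil =>
        have h1 : f <:+ v := ⟨α, by simpa using hv⟩
        have h2 : f = S := by
          have := List.suffix_of_suffix_length_le h1 hS (by omega)
          exact this.eq_of_length (by omega)
        exact ⟨z, by rw [h2]; exact hSz⟩
      | cons e β => exact ⟨e, α, β, by rw [← hv]; simp⟩
    obtain ⟨e, he⟩ := this
    have hmem : f ++ [e] ∈ Fac v (n + 1) := by
      rw [mem_Fac]; exact ⟨he, by simp [hfn]⟩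
    have htake : (f ++ [e]).take n = f := by rw [← hfn]; simp
    rw [Finset.mem_image]
    by_cases e1 : f ++ [e] = x1
    · refine ⟨x2, ?_, ?_⟩
      · simp [a1, a2, hx2]
      · show x2.take n = f; rw [← hx, ← e1, htake]
    · by_cases e2 : f ++ [e] = y1
      · refine ⟨y2, ?_, ?_⟩
        · simp [a3, a4, hy2]
        · show y2.take n = f; rw [← hy, ← e2, htake]
      · exact ⟨f ++ [e], by simp [e1, e2, hmem], htake⟩
  have h1 := (Finset.card_le_card hsub).trans Finset.card_image_le
  rw [Finset.card_erase_of_mem (by simp [h12.symm, hy1]), Finset.card_erase_of_mem hx1] at h1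
  have h2 := hD n hn
  rw [C_eq, C_eq] at h2
  have h3 : 1 < (Fac v (n + 1)).card := Finset.one_lt_card.mpr ⟨x1, hx1, y1, hy1, h12⟩
  omega

/-- There is at most one right special factor of length `n`, and it has valence at most two. -/
def UR (v : List A) (n : ℕ) : Prop := ∀ f f' c d c' d', f.length = n → f'.length = n →
  c ≠ d → c' ≠ d' → f ++ [c] <:+: v → f ++ [d] <:+: v → f' ++ [c'] <:+: v → f' ++ [d'] <:+: v →
  f = f' ∧ (c' = c ∨ c' = d)

theorem UR_of_rep (v : List A) (n : ℕ) (hD : Slow v) (hn : 1 ≤ n) (hR : Rep v n) : UR v n := by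
  intro f f' c d c' d' hf hf' hcd hcd' h1 h2 h3 h4
  have key : ∀ (g : List A) (e : A), g.length = n → (g ++ [e]).take n = g := by
    intro g e hg; rw [← hg]; simp
  have mem : ∀ (g : List A) (e : A), g.length = n → g ++ [e] <:+: v → g ++ [e] ∈ Fac v (n + 1) := by
    intro g e hg h
    rw [mem_Fac]; exact ⟨h, by simp [hg]⟩
  have hff : f = f' := by
    by_contra hne
    have hne' : ∀ e e', f ++ [e] ≠ f' ++ [e'] := by
      intro e e' h
      exact hne (List.append_inj_left h (by omega))
    refine count v n hD hn hR (f ++ [c]) (f ++ [d]) (f' ++ [c']) (f' ++ [d']) (mem _ _ hf h1)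
      (mem _ _ hf h2) (mem _ _ hf' h3) (mem _ _ hf' h4) (hne' _ _) ?_ ?_ ?_ (hne' _ _)
      (hne' _ _).symm ?_
    · rw [key _ _ hf, key _ _ hf]
    · rw [key _ _ hf', key _ _ hf']
    · simpa using hcd.symm
    · simpa using hcd'.symm
  refine ⟨hff, ?_⟩
  subst hff
  by_contra hcon
  push Not at hcon
  refine count v n hD hn hR (f ++ [c]) (f ++ [d]) (f ++ [c']) (f ++ [d]) (mem _ _ hf h1)
      (mem _ _ hf h2) (mem _ _ hf' h3) (mem _ _ hf h2) ?_ ?_ ?_ ?_ ?_ ?_ ?_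
  · simpa using hcon.1.symm
  · rw [key _ _ hf, key _ _ hf]
  · rw [key _ _ hf, key _ _ hf]
  · simpa using hcd.symm
  · simpa using hcon.2.symm
  · simpa using hcd.symm
  · simpa using hcon.2.symm

theorem ext_aux (v g : List A) (n : ℕ) (hg : g.length = n) (hU : UR v n) (c d y : A) (hcd : c ≠ d)
    (h1 : g ++ [c] <:+: v) (h2 : g ++ [d] <:+: v) (β β2 : List A) (hβ : g ++ y :: β <:+ v)
    (hβ2 : g ++ y :: β2 <:+ v) (hlt : β.length < β2.length)
    (hmin : ∀ δ, g ++ δ <:+ v → (y :: β).length ≤ δ.length) :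
    ∀ γ, γ <+: β → γ <+: β2 := by
  intro γ
  induction γ using List.reverseRecOn with
  | nil => intro _; exact List.nil_prefix
  | append_singleton γ z ih =>
    intro hγ
    obtain ⟨ρ, hρ⟩ := ih ((List.prefix_append _ _).trans hγ)
    obtain ⟨δ, hδ⟩ := hγ
    have hlen := congrArg List.length hδ
    have hlen2 := congrArg List.length hρ
    simp at hlen hlen2
    cases ρ with
    | nil => simp at hlen2; omega
    | cons z' ρ =>
      have hzz : z = z' := by
        by_contra hne
        set W := g ++ y :: γ with hW
        have e1 : W ++ z :: δ <:+ v := by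
          have : W ++ z :: δ = g ++ y :: β := by rw [hW, ← hδ]; simp
          rw [this]; exact hβ
        have e2 : W ++ z' :: ρ <:+ v := by
          have : W ++ z' :: ρ = g ++ y :: β2 := by rw [hW, ← hρ]; simp
          rw [this]; exact hβ2
        have hWlen : W.length = n + γ.length + 1 := by rw [hW]; simp [hg]; omega
        have hsp : W = W.take (γ.length + 1) ++ W.drop (γ.length + 1) :=
          (List.take_append_drop _ _).symm
        set T := W.take (γ.length + 1)
        set f := W.drop (γ.length + 1) with hf
        have hfl : f.length = n := by rw [hf, List.length_drop]; omega
        have e3 : f ++ z :: δ <:+ v := by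
          refine List.IsSuffix.trans ⟨T, ?_⟩ e1
          rw [hsp]; simp
        have e4 : f ++ z' :: ρ <:+ v := by
          refine List.IsSuffix.trans ⟨T, ?_⟩ e2
          rw [hsp]; simp
        have e5 : f ++ [z] <:+: v :=
          (List.IsPrefix.isInfix ⟨δ, by simp⟩).trans e3.isInfix
        have e6 : f ++ [z'] <:+: v :=
          (List.IsPrefix.isInfix ⟨ρ, by simp⟩).trans e4.isInfix
        have e7 := (hU g f c d z z' hg hfl hcd hne h1 h2 e5 e6).1
        rw [← e7] at e3
        have := hmin _ e3
        simp at this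
        omega
      subst hzz
      exact ⟨ρ, by rw [← hρ]; simp⟩

theorem rep_of_strong (v g : List A) (n : ℕ) (hg : g.length = n) (hU : UR v n)
    (hL : UR v.reverse n) (a b c d : A) (hab : a ≠ b) (hcd : c ≠ d)
    (hac : a :: g ++ [c] <:+: v) (had : a :: g ++ [d] <:+: v)
    (hbc : b :: g ++ [c] <:+: v) (hbd : b :: g ++ [d] <:+: v) : Rep v (n + 1) := by
  have h1 : g ++ [c] <:+: v := (List.suffix_cons a _).isInfix.trans hac
  have h2 : g ++ [d] <:+: v := (List.suffix_cons a _).isInfix.trans had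
  have hex : ∃ k, ∃ δ, g ++ δ <:+ v ∧ δ.length = k := by
    obtain ⟨α, β, hv⟩ := h1
    exact ⟨_, c :: β, ⟨α, by rw [← hv]; simp⟩, rfl⟩
  classical
  obtain ⟨B, hB, hBk⟩ := Nat.find_spec hex
  have hmin : ∀ δ, g ++ δ <:+ v → B.length ≤ δ.length := by
    intro δ hδ
    rw [hBk]
    exact Nat.find_min' hex ⟨δ, hδ, rfl⟩
  cases B with
  | nil =>
    obtain ⟨α, hα⟩ := hB
    rcases List.eq_nil_or_concat α with h | ⟨α', x, h⟩
    · exfalso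
      subst h
      have := hac.length_le
      rw [← hα] at this
      simp at this
    · subst h
      have hxs : x :: g <:+ v := ⟨α', by rw [← hα]; simp⟩
      have hx : x = a ∨ x = b := by
        by_cases hxa : x = a
        · exact Or.inl hxa
        · have rv : ∀ e, e :: g <:+: v → g.reverse ++ [e] <:+: v.reverse := by
            intro e he
            rw [← List.reverse_infix] at he
            simpa using he
          have ha : a :: g <:+: v := (List.prefix_append _ _).isInfix.trans hac
          have hb : b :: g <:+: v := (List.prefix_append _ _).isInfix.trans hbc
          exact (hL g.reverse g.reverse a b x a (by simpa using hg) (by simpa using hg) hab hxa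
            (rv a ha) (rv b hb) (rv x hxs.isInfix) (rv a ha)).2
      rcases hx with h | h
      · exact ⟨x :: g, c, hxs, by simp [hg], by rw [h]; exact hac⟩
      · exact ⟨x :: g, c, hxs, by simp [hg], by rw [h]; exact hbc⟩
  | cons y β =>
    have hgy : g ++ [y] <:+: v := (List.IsPrefix.isInfix ⟨β, by simp⟩).trans hB.isInfix
    have hy : y = c ∨ y = d := by
      by_cases hyc : y = c
      · exact Or.inl hyc
      · exact (hU g g c d y c hg hg hcd hyc h1 h2 hgy h1).2
    have hay : a :: g ++ [y] <:+: v := by rcases hy with h | h <;> rw [h] <;> assumption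
    have hby : b :: g ++ [y] <:+: v := by rcases hy with h | h <;> rw [h] <;> assumption
    have hocc : ∃ β2, g ++ y :: β2 <:+ v ∧ β.length < β2.length := by
      obtain ⟨α1, β1, hv1⟩ := hay
      obtain ⟨α2, β2, hv2⟩ := hby
      have s1 : g ++ y :: β1 <:+ v := ⟨α1 ++ [a], by rw [← hv1]; simp⟩
      have s2 : g ++ y :: β2 <:+ v := ⟨α2 ++ [b], by rw [← hv2]; simp⟩
      have m1 := hmin _ s1
      have m2 := hmin _ s2
      simp at m1 m2
      by_cases hl : β.length < β1.length
      · exact ⟨β1, s1, hl⟩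
      · by_cases hl2 : β.length < β2.length
        · exact ⟨β2, s2, hl2⟩
        · exfalso
          have t1 : a :: g ++ y :: β1 <:+ v := ⟨α1, by rw [← hv1]; simp⟩
          have t2 : b :: g ++ y :: β2 <:+ v := ⟨α2, by rw [← hv2]; simp⟩
          have hll : (a :: g ++ y :: β1).length = (b :: g ++ y :: β2).length := by
            simp; omega
          have := (List.suffix_of_suffix_length_le t1 t2 hll.le).eq_of_length hll
          simp at this
          exact hab this.1
    obtain ⟨β2, hβ2, hlt⟩ := hocc
    obtain ⟨ρ, hρ⟩ := ext_aux v g n hg hU c d y hcd h1 h2 β β2 hB hβ2 hlt hmin β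
      (List.prefix_refl β)
    have hlen2 := congrArg List.length hρ
    cases ρ with
    | nil => simp at hlen2; omega
    | cons z ρ =>
      set W := g ++ y :: β with hW
      have hWlen : W.length = n + β.length + 1 := by rw [hW]; simp [hg]; omega
      refine ⟨W.drop β.length, z, (List.drop_suffix _ _).trans hB, by simp [hWlen]; omega, ?_⟩
      have e1 : W ++ [z] <:+: v := by
        refine List.IsInfix.trans (List.IsPrefix.isInfix ⟨ρ, ?_⟩) hβ2.isInfix
        rw [hW, ← hρ]; simp
      refine List.IsInfix.trans (List.IsSuffix.isInfix ⟨W.take β.length, ?_⟩) e1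
      rw [← List.append_assoc, List.take_append_drop]

theorem UR_succ (v : List A) (n : ℕ) (hD : Slow v) (hU : UR v n)
    (hL : UR v.reverse n) : UR v (n + 1) := by
  intro f f' c d c' d' hf hf' hcd hcd' h1 h2 h3 h4
  match f, f', hf, hf' with
  | a :: g, b :: g', hf, hf' =>
    have hg : g.length = n := by simpa using hf
    have hg' : g'.length = n := by simpa using hf'
    have tl : ∀ (x e : A) (k : List A), x :: k ++ [e] <:+: v → k ++ [e] <:+: v :=
      fun x e k h => (List.suffix_cons x _).isInfix.trans h
    have k1 := hU g g' c d c' d' hg hg' hcd hcd' (tl _ _ _ h1) (tl _ _ _ h2) (tl _ _ _ h3)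
      (tl _ _ _ h4)
    have k2 := hU g g' c d d' c' hg hg' hcd hcd'.symm (tl _ _ _ h1) (tl _ _ _ h2) (tl _ _ _ h4)
      (tl _ _ _ h3)
    obtain ⟨rfl, k1⟩ := k1
    obtain ⟨_, k2⟩ := k2
    refine ⟨?_, k1⟩
    by_contra hne
    have hab : a ≠ b := by rintro rfl; exact hne rfl
    have hbcd : b :: g ++ [c] <:+: v ∧ b :: g ++ [d] <:+: v := by
      rcases k1 with rfl | rfl
      · rcases k2 with rfl | rfl
        · exact absurd rfl hcd'
        · exact ⟨h3, h4⟩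
      · rcases k2 with rfl | rfl
        · exact ⟨h4, h3⟩
        · exact absurd rfl hcd'
    have hR := rep_of_strong v g n hg hU hL a b c d hab hcd h1 h2 hbcd.1 hbcd.2
    have := UR_of_rep v (n + 1) hD (by omega) hR (a :: g) (b :: g) c d c d hf (by simp [hg]) hcd hcd
      h1 h2 hbcd.1 hbcd.2
    exact hne this.1

theorem UR_all (v : List A) (hD : Slow v) (h1 : Rep v 1) (h2 : Rep v.reverse 1) (n : ℕ) :
    UR v (n + 1) ∧ UR v.reverse (n + 1) := by
  induction n with
  | zero => exact ⟨UR_of_rep v 1 hD le_rfl h1, UR_of_rep _ 1 hD.rev le_rfl h2⟩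
  | succ n ih =>
    exact ⟨UR_succ v _ hD ih.1 ih.2, UR_succ _ _ hD.rev ih.2 (by simpa using ih.1)⟩

/-- no nonempty strong bispecial factors -/
theorem no_strong (v : List A) (hU : ∀ n, UR v (n + 1)) (a b : A) (hab : a ≠ b) (g : List A) :
    ¬ Strong v a b g := by
  rintro ⟨e1, e2, e3, e4⟩
  have := (hU g.length (a :: g) (b :: g) a b a b rfl (by simp) hab hab e1 e2 e3 e4).1
  simp at this
  exact hab this

end GTW

namespace GTW

theorem C_zero_of_lt (w : List A) (n : ℕ) (h : w.length < n) : C w n = 0 := by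
  rw [C_eq, Finset.card_eq_zero, Finset.eq_empty_iff_forall_notMem]
  intro f hf
  rw [mem_Fac] at hf
  have := hf.1.length_le
  omega

theorem slow_of_GT (w : List A) (hw : IsGT w) (h1 : (Alph w).card ≠ 1) : Slow w := by
  obtain ⟨_, h | ⟨m, M, hm, hmM, hA, hB, hC⟩⟩ := hw
  · exact absurd h h1
  intro n hn
  by_cases c1 : n + 1 ≤ m
  · rw [hA n hn (by omega), hA (n + 1) (by omega) c1]; omega
  by_cases c2 : n ≤ M - 1
  · rw [hB n (by omega) c2]; omega
  by_cases c3 : n ≤ w.length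
  · rw [hC n (by omega) c3]; omega
  · rw [C_zero_of_lt w (n + 1) (by omega)]; omega

theorem C_cons (x : A) (w : List A) (hx : x ∉ w) (n : ℕ) (h1 : 1 ≤ n) (h2 : n ≤ w.length + 1) :
    C (x :: w) n = C w n + 1 := by
  have : Fac (x :: w) n = insert (x :: w.take (n - 1)) (Fac w n) := by
    ext f
    rw [Finset.mem_insert, mem_Fac, mem_Fac, List.infix_cons_iff]
    constructor
    · rintro ⟨h | h, hl⟩
      · left
        have e1 : f = (x :: w).take n := by
          rw [← hl]; exact List.prefix_iff_eq_take.mp h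
        obtain ⟨k, rfl⟩ : ∃ k, n = k + 1 := ⟨n - 1, by omega⟩
        simpa using e1
      · exact Or.inr ⟨h, hl⟩
    · rintro (h | h)
      · subst h
        refine ⟨Or.inl ?_, ?_⟩
        · rw [List.cons_prefix_cons]; exact ⟨rfl, List.take_prefix _ _⟩
        · simp; omega
      · exact ⟨Or.inr h.1, h.2⟩
  rw [C_eq, C_eq, this, Finset.card_insert_of_notMem]
  intro h
  rw [mem_Fac] at h
  exact hx (h.1.subset (by simp))

theorem Slow.peel {x : A} {w : List A} (h : Slow (x :: w)) (hx : x ∉ w) : Slow w := by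
  intro n hn
  by_cases c : n ≤ w.length
  · have := h n hn
    rw [C_cons x w hx n hn (by omega), C_cons x w hx (n + 1) (by omega) (by omega)] at this
    omega
  · rw [C_zero_of_lt w (n + 1) (by omega)]; omega

theorem Slow.peels {r w : List A} (hr : ∀ x ∈ r, (r ++ w).count x = 1) (h : Slow (r ++ w)) :
    Slow w := by
  induction r with
  | nil => simpa using h
  | cons x r ih =>
    have hx : x ∉ r ++ w := by
      have := hr x (by simp)
      rw [List.cons_append, List.count_cons_self] at this
      rw [← List.count_eq_zero]; omega
    refine ih ?_ (Slow.peel h hx)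
    intro y hy
    have := hr y (by simp [hy])
    have hne : x ≠ y := by rintro rfl; exact hx (by simp [hy])
    rwa [List.cons_append, List.count_cons_of_ne hne] at this

theorem heart_spec (w : List A) (hn : ¬ ∀ x ∈ w, w.count x = 1) :
    ∃ r s, w = r ++ heart w ++ s ∧ (∀ x ∈ r, w.count x = 1) ∧ (∀ x ∈ s, w.count x = 1) ∧
      (∀ x, (heart w).head? = some x → w.count x ≠ 1) ∧
      (∀ x, (heart w).getLast? = some x → w.count x ≠ 1) := by
  rw [heart, if_neg hn]
  set P : A → Bool := fun x => w.count x == 1 with hP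
  set D := w.dropWhile P with hD
  set E := D.reverse.dropWhile P with hE
  have e1 : w = w.takeWhile P ++ D := (List.takeWhile_append_dropWhile).symm
  have e2 : D.reverse = D.reverse.takeWhile P ++ E := (List.takeWhile_append_dropWhile).symm
  have e3 : D = E.reverse ++ (D.reverse.takeWhile P).reverse := by
    have := congrArg List.reverse e2
    simpa using this
  have tw : ∀ (l : List A) x, x ∈ l.takeWhile P → w.count x = 1 := by
    intro l x hx
    have := List.mem_takeWhile_imp hx
    simpa [hP] using this
  have hd : ∀ (l : List A) x, (l.dropWhile P).head? = some x → w.count x ≠ 1 := by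
    intro l x hx
    have := List.head?_dropWhile_not P l
    rw [hx] at this
    simpa [hP] using this
  refine ⟨w.takeWhile P, (D.reverse.takeWhile P).reverse, ?_, tw w, ?_, ?_, ?_⟩
  · rw [List.append_assoc, ← e3]; exact e1
  · intro x hx
    exact tw _ x (by simpa using hx)
  · intro x hx
    apply hd w x
    rw [← hD, e3]
    rw [List.head?_append, hx]; rfl
  · intro x hx
    apply hd D.reverse x
    rw [← hE]
    simpa using hx

theorem rep_one (v : List A) (x : A) (h : v.getLast? = some x) (hc : 2 ≤ v.count x) : Rep v 1 := by
  rcases List.eq_nil_or_concat v with h0 | ⟨v', z, h0⟩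
  · subst h0; simp at h
  · subst h0
    have hz : z = x := by simpa using h
    subst hz
    have : z ∈ v' := by
      rw [← List.count_pos_iff]
      simp at hc
      simpa using hc
    obtain ⟨α, β, rfl⟩ := List.append_of_mem this
    cases β with
    | nil => exact ⟨[z], z, ⟨α ++ [z], by simp⟩, rfl, α, [], by simp⟩
    | cons y β => exact ⟨[z], y, ⟨α ++ z :: y :: β, by simp⟩, rfl, α, β ++ [z], by simp⟩

theorem heart_UR (w : List A) (hw : IsGT w) (h1 : (Alph w).card ≠ 1) (y : A)
    (hy : 2 ≤ (heart w).count y) (n : ℕ) : UR (heart w) (n + 1) ∧ UR (heart w).reverse (n + 1) := by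
  have hS := slow_of_GT w hw h1
  have hn : ¬ ∀ x ∈ w, w.count x = 1 := by
    intro h
    have : heart w = w := by rw [heart, if_pos h]
    rw [this] at hy
    have := h y (by rw [← List.count_pos_iff]; omega)
    omega
  obtain ⟨r, s, hw', hr, hs, hh, hl⟩ := heart_spec w hn
  set v := heart w
  have cnt : ∀ x, x ∈ v → w.count x ≠ 1 → 2 ≤ v.count x := by
    intro x hx hc
    have a1 : r.count x = 0 := by
      rw [List.count_eq_zero]; intro h; exact hc (hr x h)
    have a2 : s.count x = 0 := by
      rw [List.count_eq_zero]; intro h; exact hc (hs x h)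
    have a3 := congrArg (List.count x) hw'
    rw [List.count_append, List.count_append] at a3
    have := List.count_pos_iff.mpr hx
    omega
  have hv0 : v ≠ [] := by rintro h; rw [h] at hy; simp at hy
  have hSv : Slow v := by
    have b1 : Slow (v ++ s) := by
      refine Slow.peels (r := r) ?_ ?_
      · intro x hx; rw [← List.append_assoc, ← hw']; exact hr x hx
      · rw [← List.append_assoc, ← hw']; exact hS
    have b2 := b1.rev
    rw [List.reverse_append] at b2
    have b3 : Slow v.reverse := by
      refine Slow.peels ?_ b2
      intro x hx
      rw [← List.reverse_append, List.count_reverse]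
      have hx' : x ∈ s := by simpa using hx
      have a3 := congrArg (List.count x) hw'
      rw [hs x hx', List.append_assoc, List.count_append] at a3
      have : 0 < (v ++ s).count x := by rw [List.count_pos_iff]; simp [hx']
      omega
    simpa using b3.rev
  refine UR_all v hSv ?_ ?_ n
  · refine rep_one v (v.getLast hv0) (List.getLast?_eq_some_getLast hv0) ?_
    exact cnt _ (List.getLast_mem hv0) (hl _ (List.getLast?_eq_some_getLast hv0))
  · refine rep_one v.reverse (v.head hv0) (by rw [List.getLast?_reverse]; exact List.head?_eq_some_head hv0) ?_
    rw [List.count_reverse]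
    exact cnt _ (List.head_mem hv0) (hh _ (List.head?_eq_some_head hv0))

end GTW

namespace GTW

/-- palindromic factors -/
def Pal (w : List A) : Finset (List A) := (factors w).filter (fun u => u.reverse = u)

theorem mem_Pal (w u : List A) : u ∈ Pal w ↔ u <:+: w ∧ u.reverse = u := by
  simp [Pal, mem_factors]

theorem Pal_reverse (w : List A) : Pal w.reverse = Pal w := by
  ext u
  rw [mem_Pal, mem_Pal]
  constructor
  · rintro ⟨h, e⟩
    refine ⟨?_, e⟩
    rw [← List.reverse_infix, e]; exact h
  · rintro ⟨h, e⟩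
    refine ⟨?_, e⟩
    rw [← List.reverse_infix, List.reverse_reverse, e]; exact h

theorem new_suffix (w u : List A) (x : A) (h : u <:+: w ++ [x]) (h' : ¬ u <:+: w) :
    u <:+ w ++ [x] := by
  obtain ⟨α, β, hv⟩ := h
  rcases List.eq_nil_or_concat β with h0 | ⟨β', z, h0⟩
  · subst h0; exact ⟨α, by simpa using hv⟩
  · exfalso
    subst h0
    have : (α ++ u ++ β') ++ [z] = w ++ [x] := by rw [← hv]; simp
    have := List.append_inj_left' this rfl
    exact h' ⟨α, β', this⟩

theorem new_unique (w S T : List A) (x : A) (hS : S <:+ w ++ [x]) (hT : T <:+ w ++ [x])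
    (pS : S.reverse = S) (pT : T.reverse = T) (nS : ¬ S <:+: w) (hle : S.length ≤ T.length) :
    S = T := by
  have h1 : S <:+ T := List.suffix_of_suffix_length_le hS hT hle
  have h2 : S <+: T := by
    rw [← List.reverse_suffix, pS, pT]; exact h1
  obtain ⟨γ, hγ⟩ := h2
  rcases List.eq_nil_or_concat γ with h0 | ⟨γ', z, h0⟩
  · subst h0; simpa using hγ
  · exfalso
    subst h0
    obtain ⟨δ, hδ⟩ := hT
    have : (δ ++ S ++ γ') ++ [z] = w ++ [x] := by rw [← hδ, ← hγ]; simp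
    have := List.append_inj_left' this rfl
    exact nS ⟨δ, γ', this⟩

theorem Pal_concat (w : List A) (x : A) : (Pal (w ++ [x])).card ≤ (Pal w).card + 1 := by
  have h1 : (Pal (w ++ [x]) \ Pal w).card ≤ 1 := by
    rw [Finset.card_le_one]
    intro S hS T hT
    rw [Finset.mem_sdiff, mem_Pal, mem_Pal] at hS hT
    have nS : ¬ S <:+: w := fun h => hS.2 ⟨h, hS.1.2⟩
    have nT : ¬ T <:+: w := fun h => hT.2 ⟨h, hT.1.2⟩
    have sS := new_suffix w S x hS.1.1 nS
    have sT := new_suffix w T x hT.1.1 nT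
    rcases le_total S.length T.length with h | h
    · exact new_unique w S T x sS sT hS.1.2 hT.1.2 nS h
    · exact (new_unique w T S x sT sS hT.1.2 hS.1.2 nT h).symm
  have h2 := Finset.card_le_card_sdiff_add_card (s := Pal (w ++ [x])) (t := Pal w)
  omega

theorem Pal_append (w β : List A) : (Pal (w ++ β)).card ≤ (Pal w).card + β.length := by
  induction β using List.reverseRecOn with
  | nil => simp
  | append_singleton β x ih =>
    have := Pal_concat (w ++ β) x
    rw [← List.append_assoc]
    simp only [List.length_append, List.length_singleton]
    omega

theorem Pal_append_left (w α : List A) : (Pal (α ++ w)).card ≤ (Pal w).card + α.length := by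
  have := Pal_append w.reverse α.reverse
  rw [← List.reverse_append, Pal_reverse, Pal_reverse] at this
  simpa using this

theorem Pal_le (w : List A) : (Pal w).card ≤ w.length + 1 := by
  have h := Pal_append ([] : List A) w
  have h0 : (Pal ([] : List A)).card ≤ 1 := by
    rw [Finset.card_le_one]
    intro S hS T hT
    rw [mem_Pal] at hS hT
    rw [List.infix_nil.mp hS.1, List.infix_nil.mp hT.1]
  rw [List.nil_append] at h
  omega

theorem Rich.return {w : List A} (h : Rich w) (a : A) (f : List A) (ha : a ∉ f)
    (hf : a :: f ++ [a] <:+: w) : f.reverse = f := by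
  obtain ⟨α, β, hv⟩ := hf
  have h1 : (Pal w).card = w.length + 1 := h
  have h2 := Pal_append (α ++ (a :: f ++ [a])) β
  have h3 := Pal_append_left (a :: f ++ [a]) α
  have h4 := Pal_le (a :: f)
  rw [hv] at h2
  have h5 := congrArg List.length hv
  simp at h5
  simp at h4
  have h6 : (Pal (a :: f)).card < (Pal (a :: f ++ [a])).card := by omega
  obtain ⟨S, hS, hS'⟩ := Finset.exists_mem_notMem_of_card_lt_card h6
  rw [mem_Pal] at hS hS'
  have nS : ¬ S <:+: a :: f := fun h => hS' ⟨h, hS.2⟩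
  have sS := new_suffix _ S a hS.1 nS
  obtain ⟨δ, hδ⟩ := sS
  rcases List.eq_nil_or_concat S with h0 | ⟨S', z, h0⟩
  · subst h0; exact absurd (List.nil_infix) nS
  have hz : δ ++ S' = a :: f ∧ z = a := by
    subst h0
    have : (δ ++ S') ++ [z] = (a :: f) ++ [a] := by rw [← hδ]; simp
    exact ⟨List.append_inj_left' this rfl, by simpa using List.append_inj_right' this rfl⟩
  obtain ⟨hz1, rfl⟩ := hz
  cases δ with
  | nil =>
    simp at hδ
    have := hS.2
    rw [hδ] at this
    simpa using this
  | cons y δ =>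
    exfalso
    simp at hz1
    have hS2 := hS.2
    cases S' with
    | nil =>
      apply nS
      rw [h0]
      exact ⟨[], f, by simp⟩
    | cons y' S'' =>
      rw [h0] at hS2
      simp at hS2
      apply ha
      rw [← hz1.2, ← hS2.1]
      simp

theorem reach {v : List A} (P : A → Prop) (hc : ∀ x y, P x → [x, y] <:+: v → P y) :
    ∀ (t : List A) (a : A), P a → a :: t <:+: v → ∀ x ∈ a :: t, P x := by
  intro t
  induction t with
  | nil => intro a ha _ x hx; simp at hx; rw [hx]; exact ha
  | cons b t ih =>
    intro a ha h x hx
    have hb : P b := hc a b ha (List.IsInfix.trans ⟨[], t, by simp⟩ h)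
    rcases List.mem_cons.mp hx with rfl | hx
    · exact ha
    · exact ih b hb ((List.suffix_cons a _).isInfix.trans h) x hx

/-- The word is neither binary nor star shaped. -/
structure Core (v : List A) : Prop where
  ur : UR v 1
  nb : ∀ a b, ¬ ∀ x ∈ v, x = a ∨ x = b
  ns : ∀ s c d, c ≠ d → (∀ x ∈ v, x = s ∨ x = c ∨ x = d) →
    (∀ x y, [x, y] <:+: v → x = s ∨ y = s) → [s, s] <:+: v

theorem UR1 {v : List A} (h : UR v 1) {f f' c d c' d' : A} (hcd : c ≠ d) (hcd' : c' ≠ d')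
    (h1 : [f, c] <:+: v) (h2 : [f, d] <:+: v) (h3 : [f', c'] <:+: v) (h4 : [f', d'] <:+: v) :
    f = f' ∧ (c' = c ∨ c' = d) := by
  have := h [f] [f'] c d c' d' rfl rfl hcd hcd' h1 h2 h3 h4
  simpa using this

theorem tri_closed {v : List A} (h : UR v 1) {s c d : A} (hcd : c ≠ d) (h1 : [c, s] <:+: v)
    (h2 : [d, s] <:+: v) (h3 : [s, c] <:+: v) (h4 : [s, d] <:+: v) (x y : A)
    (hx : x = s ∨ x = c ∨ x = d) (hxy : [x, y] <:+: v) :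
    (y = c ∨ y = d) ∧ x = s ∨ y = s := by
  by_cases hys : y = s
  · exact Or.inr hys
  have hxs : x = s := by
    rcases hx with rfl | rfl | rfl
    · rfl
    · exact (UR1 h hcd hys h3 h4 hxy h1).1.symm
    · exact (UR1 h hcd hys h3 h4 hxy h2).1.symm
  subst hxs
  left
  refine ⟨?_, rfl⟩
  by_cases hyc : y = c
  · exact Or.inl hyc
  · exact (UR1 h hcd hyc h3 h4 hxy h3).2

theorem tri_reach {v : List A} (h : UR v 1) {s c d : A} (hcd : c ≠ d) (h1 : [c, s] <:+: v)
    (h2 : [d, s] <:+: v) (h3 : [s, c] <:+: v) (h4 : [s, d] <:+: v) (a : A) (t : List A)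
    (ha : a = s ∨ a = c ∨ a = d) (hat : a :: t <:+: v) :
    ∀ x ∈ a :: t, x = s ∨ x = c ∨ x = d := by
  refine reach (v := v) (fun x => x = s ∨ x = c ∨ x = d) ?_ t a ha hat
  intro x y hx hxy
  have := tri_closed h hcd h1 h2 h3 h4 x y hx hxy
  tauto

theorem tri_end {v : List A} (h : Core v) {s c d : A} (hcd : c ≠ d) (h1 : [c, s] <:+: v)
    (h2 : [d, s] <:+: v) (h3 : [s, c] <:+: v) (h4 : [s, d] <:+: v)
    (hall : ∀ x ∈ v, x = s ∨ x = c ∨ x = d) : False := by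
  by_cases hsc : s = c
  · refine h.nb s d ?_
    intro x hx
    have := hall x hx
    rw [← hsc] at this
    tauto
  by_cases hsd : s = d
  · refine h.nb s c ?_
    intro x hx
    have := hall x hx
    rw [← hsd] at this
    tauto
  have hss := h.ns s c d hcd hall (by
    intro x y hxy
    have := tri_closed h.ur hcd h1 h2 h3 h4 x y (hall x (hxy.subset (by simp))) hxy
    tauto)
  rcases (UR1 h.ur hcd hsc h3 h4 hss h3).2 with e | e
  · exact hsc e
  · exact hsd e

theorem per2 : ∀ (l : List A) (x y : A), (∀ a b c, [a, b, c] <:+: x :: y :: l → a = c) →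
    ∀ z ∈ x :: y :: l, z = x ∨ z = y := by
  intro l
  induction l with
  | nil => intro x y _ z hz; simpa using hz
  | cons t l ih =>
    intro x y h z hz
    have e : x = t := h x y t ⟨[], l, by simp⟩
    subst e
    rcases List.mem_cons.mp hz with rfl | hz
    · exact Or.inl rfl
    · have := ih y x (fun a b c hh => h a b c (hh.trans (List.suffix_cons _ _).isInfix)) z hz
      tauto

theorem part1_aux {v q : List A} (h : Core v) (hq : q <:+: v) (hpal : q.reverse = q)
    (hall : ∀ x ∈ v, x ∈ q) (α β : List A) (c s d : A) (hcd : c ≠ d)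
    (hα : q = α ++ [c, s, d] ++ β) (hle : α.length ≤ β.length) : False := by
  have hrev : q = β.reverse ++ [d, s, c] ++ α.reverse := by
    rw [← hpal, hα]; simp
  have i1 : ∀ m, m <:+: q → m <:+: v := fun m hm => hm.trans hq
  have e1 : [c, s] <:+: v := i1 _ ⟨α, d :: β, by rw [hα]; simp⟩
  have e2 : [s, d] <:+: v := i1 _ ⟨α ++ [c], β, by rw [hα]; simp⟩
  have e3 : [d, s] <:+: v := i1 _ ⟨β.reverse, c :: α.reverse, by rw [hrev]; simp⟩
  have e4 : [s, c] <:+: v := i1 _ ⟨β.reverse ++ [d], α.reverse, by rw [hrev]; simp⟩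
  have r := tri_reach h.ur hcd e1 e3 e4 e2 c ([s, d] ++ β) (by simp)
    (i1 _ ⟨α, [], by rw [hα]; simp⟩)
  refine tri_end h hcd e1 e3 e4 e2 ?_
  intro x hx
  have hxq := hall x hx
  have hpre : α <+: β.reverse := by
    refine List.prefix_of_prefix_length_le (l₃ := q) ⟨[c, s, d] ++ β, by rw [hα]; simp⟩
      ⟨[d, s, c] ++ α.reverse, by rw [hrev]; simp⟩ (by simpa using hle)
  rw [hα, List.append_assoc, List.mem_append] at hxq
  rcases hxq with hxq | hxq
  · have : x ∈ β := by simpa using hpre.subset hxq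
    exact r x (by simp [this])
  · exact r x (by simpa using hxq)

theorem part1 {v q : List A} (h : Core v) (hv0 : v ≠ []) (hq : q <:+: v) (hpal : q.reverse = q)
    (hall : ∀ x ∈ v, x ∈ q) : False := by
  by_cases hp : ∀ a b c, [a, b, c] <:+: q → a = c
  · match q, hall, hp with
    | [], hall, _ =>
      cases v with
      | nil => exact hv0 rfl
      | cons x v => simpa using hall x (by simp)
    | [y], hall, _ => exact h.nb y y (fun x hx => by simpa using hall x hx)
    | x :: y :: l, hall, hp => exact h.nb x y (fun z hz => per2 l x y hp z (hall z hz))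
  · push Not at hp
    obtain ⟨c, s, d, ⟨α, β, hα⟩, hcd⟩ := hp
    rcases le_total α.length β.length with hle | hle
    · exact part1_aux h hq hpal hall α β c s d hcd hα.symm hle
    · refine part1_aux h hq hpal hall β.reverse α.reverse d s c hcd.symm ?_ (by simpa using hle)
      rw [← hpal, ← hα]; simp

theorem part2 {v : List A} (h : Core v) (a x : A) (t f0 f : List A) (hv : v = a :: t)
    (h0 : a :: f0 ++ [a] <:+: v) (p0 : f0.reverse = f0) (h1 : a :: f ++ [a] <:+: v)
    (p1 : f.reverse = f) (hx : x ∈ f) (hx0 : x ∉ f0) (ha : a ∉ f) : False := by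
  have fin : ∀ s c d, c ≠ d → [c, s] <:+: v → [d, s] <:+: v → [s, c] <:+: v → [s, d] <:+: v →
      (a = s ∨ a = c ∨ a = d) → False := by
    intro s c d hcd e1 e2 e3 e4 has
    refine tri_end h hcd e1 e2 e3 e4 ?_
    have := tri_reach h.ur hcd e1 e2 e3 e4 a t has (by rw [hv])
    rwa [hv]
  -- reversal of the return words
  have rv : ∀ g : List A, g.reverse = g → (a :: g ++ [a]).reverse = a :: g ++ [a] := by
    intro g hg; simp [hg]
  have inf : ∀ g m : List A, g.reverse = g → a :: g ++ [a] <:+: v → m <:+: a :: g ++ [a] →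
      m <:+: v ∧ m.reverse <:+: v := by
    intro g m hg hgv hm
    refine ⟨hm.trans hgv, ?_⟩
    rw [← List.reverse_infix, rv g hg] at hm
    exact hm.trans hgv
  cases f with
  | nil => simp at hx
  | cons z f =>
    have za := inf (z :: f) [a, z] p1 h1 ⟨[], f ++ [a], by simp⟩
    simp at za
    have hza : a ≠ z := by rintro rfl; simp at ha
    cases f0 with
    | nil =>
      have aa : [a, a] <:+: v := h0
      exact fin a a z hza aa za.2 aa za.1 (Or.inl rfl)
    | cons y f0 =>
      have ya := inf (y :: f0) [a, y] p0 h0 ⟨[], f0 ++ [a], by simp⟩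
      simp at ya
      by_cases hyz : y = z
      · subst hyz
        cases f with
        | nil => simp at hx hx0; exact hx0.1 hx
        | cons b f =>
          have bz := inf (y :: b :: f) [y, b] p1 h1 ⟨[a], f ++ [a], by simp⟩
          simp at bz
          have hab : a ≠ b := by rintro rfl; simp at ha
          exact fin y a b hab za.1 bz.2 za.2 bz.1 (Or.inr (Or.inl rfl))
      · exact fin a y z hyz ya.2 za.2 ya.1 za.1 (Or.inl rfl)

end GTW

namespace GTW

theorem core_of {v : List A} (hv0 : v ≠ []) (hU : ∀ n, UR v (n + 1))
    (hmax : ∀ P Q, PalPair v P Q → P.length + Q.length + 1 < v.length) : Core v := by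
  have nb : ∀ a b, ¬ ∀ x ∈ v, x = a ∨ x = b := by
    intro a b h
    have hR : Res v := by
      by_cases hab : a = b
      · subst hab
        apply res_pal v hv0
        have : v = List.replicate v.length a :=
          List.eq_replicate_of_mem (fun x hx => by simpa using h x hx)
        rw [this]; simp
      · exact bin v.length a b v hab le_rfl hv0 h (no_strong v hU a b hab)
    obtain ⟨P, Q, hPQ, hl, _⟩ := hR
    have := hmax P Q hPQ
    omega
  refine ⟨hU 0, nb, ?_⟩
  intro s c d hcd hall hedge
  by_contra hss
  have hl : 2 ≤ v.length := by
    by_contra hl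
    match v, hv0, hl, nb with
    | [y], _, _, nb => exact nb y y (by simp)
    | _ :: _ :: _, _, hl, _ => simp at hl
  obtain ⟨P, Q, hPQ, hl⟩ := star s c d v hcd hall hedge hss hl
    (fun g _ => no_strong v hU c d hcd g)
  have := hmax P Q hPQ
  omega

theorem part2_full {v p q u : List A} (h : Core v) (hv : v = p ++ u ++ q) (hp0 : p ≠ [])
    (hpmax : ∀ p' : List A, p' <+: v → p'.reverse = p' → p'.length ≤ p.length)
    (hsub : ∀ x ∈ p, x ∈ q) (x : A) (hxu : x ∈ u) (hxp : x ∉ p)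
    (hret : ∀ a f, a ∉ f → a :: f ++ [a] <:+: v → f.reverse = f) : False := by
  cases p with
  | nil => exact hp0 rfl
  | cons a p =>
    have haq : a ∈ q := hsub a (by simp)
    have hxa : a ≠ x := by rintro rfl; simp at hxp
    obtain ⟨f0, δ0, e0, hf0⟩ := List.eq_append_cons_of_mem
      (show a ∈ p ++ u ++ q by simp [haq])
    have v0 : v = (a :: f0 ++ [a]) ++ δ0 := by
      rw [hv]; simp only [List.cons_append]; rw [e0]; simp
    have i0 : a :: f0 ++ [a] <:+: v := (List.IsPrefix.isInfix ⟨δ0, v0.symm⟩)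
    have p0 := hret a f0 hf0 i0
    have l0 := hpmax (a :: f0 ++ [a]) ⟨δ0, v0.symm⟩ (by simp [p0])
    have pre0 : a :: f0 ++ [a] <+: a :: p :=
      List.prefix_of_prefix_length_le ⟨δ0, v0.symm⟩ ⟨u ++ q, by rw [hv]; simp⟩ l0
    have hx0 : x ∉ f0 := by
      intro hh
      exact hxp (pre0.subset (by simp [hh]))
    obtain ⟨u1, u2, rfl⟩ := List.append_of_mem hxu
    obtain ⟨g', δ, e1, hg'⟩ := List.eq_append_cons_of_mem (show a ∈ u2 ++ q by simp [haq])
    obtain ⟨g, γ, e2, hg⟩ := List.eq_append_cons_of_mem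
      (show a ∈ ((a :: p) ++ u1).reverse by simp)
    have e3 : (a :: p) ++ u1 = γ.reverse ++ a :: g.reverse := by
      have := congrArg List.reverse e2
      rw [List.reverse_reverse] at this
      rw [this]; simp
    have i1 : a :: (g.reverse ++ x :: g') ++ [a] <:+: v := by
      refine ⟨γ.reverse, δ, ?_⟩
      have : v = ((a :: p) ++ u1) ++ x :: (u2 ++ q) := by rw [hv]; simp
      rw [this, e3, e1]; simp
    have hf : a ∉ g.reverse ++ x :: g' := by simp [hg, hg', hxa]
    exact part2 h a x (p ++ (u1 ++ x :: u2) ++ q) f0 (g.reverse ++ x :: g') (by rw [hv]; simp)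
      i0 p0 i1 (hret a _ hf i1) (by simp) hx0 hf

theorem main_aux (w v p q u : List A) (hw : IsGT w) (hv : v = heart w)
    (hp : p <+: v) (hppal : p.reverse = p)
    (hpmax : ∀ p' : List A, p' <+: v → p'.reverse = p' → p'.length ≤ p.length)
    (hq : q <:+ v) (hqpal : q.reverse = q)
    (hqmax : ∀ q' : List A, q' <:+ v → q'.reverse = q' → q'.length ≤ q.length)
    (hulen : 2 ≤ u.length) (hvpq : v = p ++ u ++ q)
    (hsub : (∀ x ∈ p, x ∈ q) ∨ (∀ x ∈ q, x ∈ p)) :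
    ¬ (∀ x ∈ u, x ∈ p ∨ x ∈ q) ∧ ¬ Rich w := by
  have hvlen := congrArg List.length hvpq
  simp only [List.length_append] at hvlen
  have hv0 : v ≠ [] := by rintro h; rw [h] at hvlen; simp at hvlen; omega
  have hp0 : p ≠ [] := by
    rintro h
    have := hpmax [v.head hv0] ⟨v.tail, by simp⟩ (by simp)
    rw [h] at this; simp at this
  have hq0 : q ≠ [] := by
    rintro h
    have := hqmax [v.getLast hv0] ⟨v.dropLast, List.dropLast_append_getLast hv0⟩ (by simp)
    rw [h] at this; simp at this
  have hmax : ∀ P Q, PalPair v P Q → P.length + Q.length + 1 < v.length := by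
    rintro P Q ⟨_, _, c, d, e, f⟩
    have h1 := hpmax P e c
    have h2 := hqmax Q (by rw [← List.reverse_prefix, d]; exact f) d
    omega
  have hvw : v <:+: w := by
    rw [hv]
    by_cases hn : ∀ x ∈ w, w.count x = 1
    · rw [heart, if_pos hn]
    · obtain ⟨r, s, h, _⟩ := heart_spec w hn
      exact ⟨r, s, h.symm⟩
  have hcard : (Alph w).card ≠ 1 := by
    intro h
    obtain ⟨a, ha⟩ := Finset.card_eq_one.mp h
    have hva : ∀ x ∈ v, x = a := by
      intro x hx
      have : x ∈ Alph w := by simpa [Alph] using hvw.subset hx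
      rw [ha] at this
      simpa using this
    have e : v = List.replicate v.length a := List.eq_replicate_of_mem hva
    have := hpmax v (List.prefix_refl v) (by rw [e]; simp)
    omega
  have hy : ∃ y, 2 ≤ v.count y := by
    have : ∃ y, y ∈ p ∧ y ∈ q := by
      rcases hsub with h | h
      · exact ⟨p.head hp0, List.head_mem hp0, h _ (List.head_mem hp0)⟩
      · exact ⟨q.head hq0, h _ (List.head_mem hq0), List.head_mem hq0⟩
    obtain ⟨y, h1, h2⟩ := this
    refine ⟨y, ?_⟩
    rw [hvpq, List.count_append, List.count_append]
    have := List.count_pos_iff.mpr h1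
    have := List.count_pos_iff.mpr h2
    omega
  obtain ⟨y, hy⟩ := hy
  have hU := fun n => heart_UR w hw hcard y (by rw [← hv]; exact hy) n
  rw [← hv] at hU
  have core : Core v := core_of hv0 (fun n => (hU n).1) hmax
  have core' : Core v.reverse := by
    refine core_of (by simpa using hv0) (fun n => (hU n).2) ?_
    intro P Q hPQ
    have := hmax Q P (by simpa using hPQ.rev)
    simp only [List.length_reverse]
    omega
  have first : ¬ (∀ x ∈ u, x ∈ p ∨ x ∈ q) := by
    intro hu
    rcases hsub with h | h
    · refine part1 core hv0 hq.isInfix hqpal ?_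
      intro x hx
      rw [hvpq, List.mem_append, List.mem_append] at hx
      rcases hx with (hx | hx) | hx
      · exact h x hx
      · rcases hu x hx with hx | hx
        · exact h x hx
        · exact hx
      · exact hx
    · refine part1 core hv0 hp.isInfix hppal ?_
      intro x hx
      rw [hvpq, List.mem_append, List.mem_append] at hx
      rcases hx with (hx | hx) | hx
      · exact hx
      · rcases hu x hx with hx | hx
        · exact hx
        · exact h x hx
      · exact h x hx
  refine ⟨first, ?_⟩
  intro hR
  push Not at first
  obtain ⟨x, hxu, hxp, hxq⟩ := first
  have hret : ∀ a f, a ∉ f → a :: f ++ [a] <:+: v → f.reverse = f :=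
    fun a f ha hf => Rich.return hR a f ha (hf.trans hvw)
  rcases hsub with h | h
  · exact part2_full core hvpq hp0 hpmax h x hxu hxp hret
  · refine part2_full (v := v.reverse) (p := q) (q := p) (u := u.reverse) core' ?_ hq0 ?_ h x
      (by simpa using hxu) hxq ?_
    · rw [hvpq]; simp [hppal, hqpal]
    · intro q' h1 h2
      refine hqmax q' ?_ h2
      rw [← List.reverse_prefix, h2]; exact h1
    · intro a f ha hf
      rw [← List.reverse_infix] at hf
      have := hret a f.reverse (by simpa using ha) (by simpa using hf)
      simpa using this.symm

end GTW

theorem stmt19 (w : List A) (hw : IsGT w) (v p q u : List A) (hv : v = heart w)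
    (hp : p <+: v) (hppal : p.reverse = p)
    (hpmax : ∀ p' : List A, p' <+: v → p'.reverse = p' → p'.length ≤ p.length)
    (hq : q <:+ v) (hqpal : q.reverse = q)
    (hqmax : ∀ q' : List A, q' <:+ v → q'.reverse = q' → q'.length ≤ q.length)
    (hulen : 2 ≤ u.length) (hvpq : v = p ++ u ++ q)
    (hsub : Alph p ⊆ Alph q ∨ Alph q ⊆ Alph p) :
    ¬ Alph u ⊆ Alph p ∪ Alph q ∧ ¬ Rich w := by
  have h := GTW.main_aux w v p q u hw hv hp hppal hpmax hq hqpal hqmax hulen hvpq (by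
    rcases hsub with h | h
    · left; intro x hx
      simpa [Alph] using h (show x ∈ Alph p by simpa [Alph] using hx)
    · right; intro x hx
      simpa [Alph] using h (show x ∈ Alph q by simpa [Alph] using hx))
  refine ⟨?_, h.2⟩
  intro hs
  apply h.1
  intro x hx
  simpa [Alph] using hs (show x ∈ Alph u by simpa [Alph] using hx)
end
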